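/- Let ρ and σ be density matrices on ℂ^d with s(ρ) ≤ s(σ). Then for every r ≥ 0 the strong converse exponent sc⁰_r(ρ‖σ) equals the Hoeffding anti-divergence H*_r(ρ‖σ). -/

import Mathlib

open scoped ENNReal ComplexOrder Classical

namespace QRD

variable {n : Type*} [Fintype n] [DecidableEq n]

/-- Functional calculus for Hermitian matrices (junk value `0` otherwise). -/
noncomputable def matFun (A : Matrix n n ℂ) (f : ℝ → ℝ) : Matrix n n ℂ :=
  if hA : A.IsHermitian then
    (hA.eigenvectorUnitary : Matrix n n ℂ) *
      Matrix.diagonal (fun i => (f (hA.eigenvalues i) : ℂ)) *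
      (star (hA.eigenvectorUnitary : Matrix n n ℂ))
  else 0

/-- The support projection `s(A)` of a Hermitian matrix. -/
noncomputable def supp (A : Matrix n n ℂ) : Matrix n n ℂ :=
  matFun A (fun x => if x = 0 then 0 else 1)

/-- The functional-calculus power `A^t` taken on the support of `A`. -/
noncomputable def matPow (A : Matrix n n ℂ) (t : ℝ) : Matrix n n ℂ :=
  matFun A (fun x => if x = 0 then 0 else x ^ t)

/-- The functional-calculus logarithm taken on the support of `A`. -/
noncomputable def matLog (A : Matrix n n ℂ) : Matrix n n ℂ :=
  matFun A Real.log

/-- `suppLE ρ σ` means `s(ρ) ≤ s(σ)`, i.e. `ker σ ⊆ ker ρ`. -/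
def suppLE (ρ σ : Matrix n n ℂ) : Prop :=
  LinearMap.ker σ.mulVecLin ≤ LinearMap.ker ρ.mulVecLin

/-- Loewner order: `A ≤ B` iff `B - A` is positive semidefinite. -/
def loewnerLE (A B : Matrix n n ℂ) : Prop := (B - A).PosSemidef

/-- A density matrix: positive semidefinite with unit trace. -/
def IsDensityMatrix (ρ : Matrix n n ℂ) : Prop := ρ.PosSemidef ∧ ρ.trace = 1

/-- The quantity `Q^*_α(ρ‖σ)`, with values in `[0,∞]`. -/
noncomputable def Qstar (α : ℝ) (ρ σ : Matrix n n ℂ) : ℝ≥0∞ :=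
  if 1 < α ∧ ¬ suppLE ρ σ then ⊤
  else ENNReal.ofReal
    ((matPow (matPow σ ((1 - α) / (2 * α)) * ρ * matPow σ ((1 - α) / (2 * α))) α).trace.re)

/-- The sandwiched Rényi `α`-divergence `D^*_α(ρ‖σ)`. -/
noncomputable def Dstar (α : ℝ) (ρ σ : Matrix n n ℂ) : EReal :=
  (((α - 1)⁻¹ : ℝ) : EReal) * (Qstar α ρ σ).log

/-- The Hoeffding anti-divergence `H^*_r(ρ‖σ)`. -/
noncomputable def Hstar (r : ℝ) (ρ σ : Matrix n n ℂ) : EReal :=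
  ⨆ α ∈ Set.Ioi (1 : ℝ), ((((α - 1) / α : ℝ) : EReal) * ((r : EReal) - Dstar α ρ σ))

/-- The Umegaki relative entropy `D(ρ‖σ)`. -/
noncomputable def Drel (ρ σ : Matrix n n ℂ) : EReal :=
  if suppLE ρ σ then (((ρ * (matLog ρ - matLog σ)).trace.re : ℝ) : EReal) else ⊤

/-- The max-relative entropy `D_max(ρ‖σ)`. -/
noncomputable def Dmax (ρ σ : Matrix n n ℂ) : EReal :=
  if ∃ γ : ℝ, 0 ≤ γ ∧ loewnerLE ρ (γ • σ) then
    ((Real.log (sInf {γ : ℝ | 0 ≤ γ ∧ loewnerLE ρ (γ • σ)}) : ℝ) : EReal)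
  else ⊤

/-- The `n`-fold Kronecker tensor power of a `d × d` matrix. -/
noncomputable def tensorPow {d : ℕ} (ρ : Matrix (Fin d) (Fin d) ℂ) (N : ℕ) :
    Matrix (Fin N → Fin d) (Fin N → Fin d) ℂ :=
  Matrix.of fun x y => ∏ i, ρ (x i) (y i)

/-- A (quantum) test: `0 ≤ T ≤ 1` in the Loewner order. -/
def IsTest {m : Type*} [Fintype m] [DecidableEq m] (T : Matrix m m ℂ) : Prop :=
  T.PosSemidef ∧ (1 - T).PosSemidef

/-- `-(1/n) log x`, with the convention `-log 0 = +∞`. -/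
noncomputable def expRate (N : ℕ) (x : ℝ) : EReal :=
  if x = 0 then ⊤ else ((-(N : ℝ)⁻¹ * Real.log x : ℝ) : EReal)

end QRD

namespace QRD

/-- The strong converse exponent `sc⁰_r(ρ‖σ)`: the infimum of
`lim_n −(1/n) log Tr(ρ^{⊗n} T_n)` over all test sequences `{T_n}` for which this limit
exists in `[−∞,+∞]` and `liminf_n −(1/n) log Tr(σ^{⊗n} T_n) > r`
(with the convention `−log 0 = +∞`). -/
noncomputable def scZero {d : ℕ} (r : ℝ) (ρ σ : Matrix (Fin d) (Fin d) ℂ) : EReal :=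
  sInf {x : EReal |
    ∃ T : (N : ℕ) → Matrix (Fin N → Fin d) (Fin N → Fin d) ℂ,
      (∀ N, IsTest (T N)) ∧
      (r : EReal) < Filter.liminf
        (fun N => expRate N ((tensorPow σ N * T N).trace.re)) Filter.atTop ∧
      Filter.Tendsto
        (fun N => expRate N ((tensorPow ρ N * T N).trace.re)) Filter.atTop (nhds x)}

end QRD

namespace QRD

lemma trace_conjTranspose_mul_self_re {m n : Type*} [Fintype m] [Fintype n]
    (M : Matrix m n ℂ) :
    (M.conjTranspose * M).trace.re = ∑ i, ∑ j, Complex.normSq (M i j) := by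
  rw [Finset.sum_comm]
  simp [Matrix.trace, Matrix.mul_apply, Complex.normSq_apply]

section Spectral

variable {n : Type*} [Fintype n] [DecidableEq n]

/-- The matrix `U * diag(a) * U⋆`. -/
noncomputable def conjDiag (U : Matrix n n ℂ) (a : n → ℝ) : Matrix n n ℂ :=
  U * Matrix.diagonal (fun i => (a i : ℂ)) * star U

lemma conjDiag_mul {U : Matrix n n ℂ} (hU : U ∈ Matrix.unitaryGroup n ℂ) (a b : n → ℝ) :
    conjDiag U a * conjDiag U b = conjDiag U (fun i => a i * b i) := by
  have h : star U * U = 1 := (Matrix.mem_unitaryGroup_iff').1 hU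
  have h2 : conjDiag U a * conjDiag U b =
      U * Matrix.diagonal (fun i => (a i : ℂ)) * (star U * U) *
        Matrix.diagonal (fun i => (b i : ℂ)) * star U := by
    simp only [conjDiag, Matrix.mul_assoc]
  rw [h2, h, Matrix.mul_one, Matrix.mul_assoc U, Matrix.diagonal_mul_diagonal]
  simp [conjDiag]

lemma trace_conjDiag {U : Matrix n n ℂ} (hU : U ∈ Matrix.unitaryGroup n ℂ) (a : n → ℝ) :
    (conjDiag U a).trace = ((∑ i, a i : ℝ) : ℂ) := by
  have h : star U * U = 1 := (Matrix.mem_unitaryGroup_iff').1 hU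
  rw [conjDiag, Matrix.trace_mul_comm, ← Matrix.mul_assoc, h, Matrix.one_mul,
    Matrix.trace_diagonal]
  simp

lemma posSemidef_conjDiag (U : Matrix n n ℂ) {a : n → ℝ} (ha : ∀ i, 0 ≤ a i) :
    (conjDiag U a).PosSemidef := by
  have h : (Matrix.diagonal (fun i => (a i : ℂ))).PosSemidef :=
    Matrix.PosSemidef.diagonal (fun i => by simpa using ha i)
  exact h.mul_mul_conjTranspose_same U

lemma isHermitian_conjDiag (U : Matrix n n ℂ) (a : n → ℝ) : (conjDiag U a).IsHermitian := by
  have h : (Matrix.diagonal (fun i => (a i : ℂ))).IsHermitian := by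
    apply Matrix.isHermitian_diagonal_of_self_adjoint
    ext i
    simp
  exact Matrix.isHermitian_mul_mul_conjTranspose U h

lemma conjDiag_one {U : Matrix n n ℂ} (hU : U ∈ Matrix.unitaryGroup n ℂ) :
    conjDiag U (fun _ => 1) = 1 := by
  simpa [conjDiag] using (Matrix.mem_unitaryGroup_iff).1 hU

lemma conjDiag_sub (U : Matrix n n ℂ) (a b : n → ℝ) :
    conjDiag U a - conjDiag U b = conjDiag U (fun i => a i - b i) := by
  simp only [conjDiag, ← Matrix.sub_mul, ← Matrix.mul_sub, Matrix.diagonal_sub]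
  simp

lemma eq_conjDiag_eigenvalues {A : Matrix n n ℂ} (hA : A.IsHermitian) :
    A = conjDiag (hA.eigenvectorUnitary : Matrix n n ℂ) hA.eigenvalues := by
  conv_lhs => rw [hA.spectral_theorem]
  rfl

lemma exists_conjDiag {A : Matrix n n ℂ} (hA : A.PosSemidef) :
    ∃ U ∈ Matrix.unitaryGroup n ℂ, ∃ a : n → ℝ, (∀ i, 0 ≤ a i) ∧ A = conjDiag U a :=
  ⟨_, (hA.1.eigenvectorUnitary).2, _, hA.eigenvalues_nonneg, eq_conjDiag_eigenvalues hA.1⟩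

lemma matFun_eq_conjDiag {A : Matrix n n ℂ} (hA : A.IsHermitian) (f : ℝ → ℝ) :
    matFun A f = conjDiag (hA.eigenvectorUnitary : Matrix n n ℂ) (fun i => f (hA.eigenvalues i)) := by
  rw [matFun, dif_pos hA]
  rfl

lemma exists_eq_conjTranspose_mul_self {A : Matrix n n ℂ} (hA : A.PosSemidef) :
    ∃ B : Matrix n n ℂ, A = B.conjTranspose * B := by
  obtain ⟨U, hU, a, ha, rfl⟩ := exists_conjDiag hA
  refine ⟨conjDiag U (fun i => √(a i)), ?_⟩
  rw [(isHermitian_conjDiag U _).eq, conjDiag_mul hU]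
  simp only [Real.mul_self_sqrt (ha _)]

lemma trace_mul_nonneg {A B : Matrix n n ℂ} (hA : A.PosSemidef) (hB : B.PosSemidef) :
    0 ≤ (A * B).trace := by
  obtain ⟨C, rfl⟩ := exists_eq_conjTranspose_mul_self hB
  rw [← Matrix.mul_assoc, Matrix.trace_mul_comm, ← Matrix.mul_assoc]
  exact (hA.mul_mul_conjTranspose_same C).trace_nonneg

lemma trace_mul_im {A B : Matrix n n ℂ} (hA : A.PosSemidef) (hB : B.PosSemidef) :
    (A * B).trace.im = 0 := ((Complex.nonneg_iff.1 (trace_mul_nonneg hA hB)).2).symm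

lemma trace_mul_re_nonneg {A B : Matrix n n ℂ} (hA : A.PosSemidef) (hB : B.PosSemidef) :
    0 ≤ (A * B).trace.re := (Complex.nonneg_iff.1 (trace_mul_nonneg hA hB)).1

lemma trace_conjDiag_mul_conjDiag (U V : Matrix n n ℂ) (a b : n → ℝ) :
    (conjDiag U a * conjDiag V b).trace.re =
      ∑ i, ∑ j, a i * b j * Complex.normSq ((star U * V) i j) := by
  have h1 : (conjDiag U a * conjDiag V b).trace =
      (Matrix.diagonal (fun i => (a i : ℂ)) * (star U * V) *
        Matrix.diagonal (fun i => (b i : ℂ)) * star (star U * V)).trace := by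
    rw [conjDiag, conjDiag, Matrix.mul_assoc U, Matrix.mul_assoc U, Matrix.trace_mul_comm U]
    simp only [star_mul, star_star, Matrix.mul_assoc]
  rw [h1]
  simp only [Matrix.trace, Matrix.diag_apply, Matrix.mul_apply (N := star (star U * V)),
    Matrix.mul_diagonal, Matrix.diagonal_mul, Complex.re_sum]
  refine Finset.sum_congr rfl fun i _ => Finset.sum_congr rfl fun j _ => ?_
  rw [Matrix.star_apply]
  generalize (star U * V) i j = z
  have : (a i : ℂ) * z * (b j : ℂ) * star z = ((a i * b j : ℝ) : ℂ) * (z * star z) := by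
    push_cast; ring
  rw [this, Complex.star_def, Complex.mul_conj, ← Complex.ofReal_mul, Complex.ofReal_re]

lemma sum_normSq_row {U : Matrix n n ℂ} (hU : U ∈ Matrix.unitaryGroup n ℂ) (i : n) :
    ∑ j, Complex.normSq (U i j) = 1 := by
  have h := congrFun (congrFun ((Matrix.mem_unitaryGroup_iff).1 hU) i) i
  rw [Matrix.mul_apply, Matrix.one_apply_eq] at h
  have h2 := congrArg Complex.re h
  simpa [Complex.normSq_apply] using h2

lemma sum_normSq_col {U : Matrix n n ℂ} (hU : U ∈ Matrix.unitaryGroup n ℂ) (j : n) :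
    ∑ i, Complex.normSq (U i j) = 1 := by
  have h := congrFun (congrFun ((Matrix.mem_unitaryGroup_iff').1 hU) j) j
  rw [Matrix.mul_apply, Matrix.one_apply_eq] at h
  have h2 := congrArg Complex.re h
  simpa [Complex.normSq_apply] using h2

/-- Hölder's inequality for the trace of a product of two positive semidefinite matrices. -/
lemma trace_mul_le_holder {U V : Matrix n n ℂ} (hU : U ∈ Matrix.unitaryGroup n ℂ)
    (hV : V ∈ Matrix.unitaryGroup n ℂ) {a b : n → ℝ} (ha : ∀ i, 0 ≤ a i) (hb : ∀ i, 0 ≤ b i)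
    {p q : ℝ} (hpq : p.HolderConjugate q) :
    (conjDiag U a * conjDiag V b).trace.re ≤
      (∑ i, a i ^ p) ^ (1 / p) * (∑ i, b i ^ q) ^ (1 / q) := by
  have hW : star U * V ∈ Matrix.unitaryGroup n ℂ := mul_mem (Unitary.star_mem hU) hV
  rw [trace_conjDiag_mul_conjDiag]
  set W := star U * V
  have hw : ∀ i j, 0 ≤ Complex.normSq (W i j) := fun i j => Complex.normSq_nonneg _
  have hp := hpq.pos
  have hq := hpq.symm.pos
  have h := Real.inner_le_Lp_mul_Lq_of_nonneg (Finset.univ : Finset (n × n))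
    (f := fun x => a x.1 * Complex.normSq (W x.1 x.2) ^ (1 / p))
    (g := fun x => b x.2 * Complex.normSq (W x.1 x.2) ^ (1 / q)) hpq
    (fun x _ => mul_nonneg (ha _) (Real.rpow_nonneg (hw _ _) _))
    (fun x _ => mul_nonneg (hb _) (Real.rpow_nonneg (hw _ _) _))
  have e1 : ∑ x : n × n, (a x.1 * Complex.normSq (W x.1 x.2) ^ (1 / p)) ^ p = ∑ i, a i ^ p := by
    rw [Fintype.sum_prod_type]
    refine Finset.sum_congr rfl fun i _ => ?_
    have : ∀ j, (a i * Complex.normSq (W i j) ^ (1 / p)) ^ p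
        = a i ^ p * Complex.normSq (W i j) := fun j => by
      rw [Real.mul_rpow (ha _) (Real.rpow_nonneg (hw _ _) _), ← Real.rpow_mul (hw _ _),
        one_div_mul_cancel hp.ne', Real.rpow_one]
    simp only [this, ← Finset.mul_sum, sum_normSq_row hW, mul_one]
  have e2 : ∑ x : n × n, (b x.2 * Complex.normSq (W x.1 x.2) ^ (1 / q)) ^ q = ∑ i, b i ^ q := by
    rw [Fintype.sum_prod_type_right]
    refine Finset.sum_congr rfl fun j _ => ?_
    have : ∀ i, (b j * Complex.normSq (W i j) ^ (1 / q)) ^ q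
        = b j ^ q * Complex.normSq (W i j) := fun i => by
      rw [Real.mul_rpow (hb _) (Real.rpow_nonneg (hw _ _) _), ← Real.rpow_mul (hw _ _),
        one_div_mul_cancel hq.ne', Real.rpow_one]
    simp only [this, ← Finset.mul_sum, sum_normSq_col hW, mul_one]
  rw [e1, e2] at h
  refine le_trans (le_of_eq ?_) h
  rw [Fintype.sum_prod_type]
  refine Finset.sum_congr rfl fun i _ => Finset.sum_congr rfl fun j _ => ?_
  have : Complex.normSq (W i j) =
      Complex.normSq (W i j) ^ (1 / p) * Complex.normSq (W i j) ^ (1 / q) := by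
    have hs : 1 / p + 1 / q = 1 := by
      simpa [one_div] using hpq.inv_add_inv_eq_one
    rw [← Real.rpow_add' (hw _ _) (by rw [hs]; exact one_ne_zero), hs, Real.rpow_one]
  conv_lhs => rw [this]
  ring

/-- The pinching inequality, in trace form. -/
lemma trace_mul_le_pinching {L : Type*} [Fintype L] {P : L → Matrix n n ℂ}
    (hP : ∀ l, (P l).IsHermitian) (hP1 : ∑ l, P l = 1) {X Z : Matrix n n ℂ}
    (hX : X.PosSemidef) (hZ : Z.PosSemidef) :
    (X * Z).trace.re ≤ Fintype.card L * ∑ l, (P l * X * P l * Z).trace.re := by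
  obtain ⟨B, rfl⟩ := exists_eq_conjTranspose_mul_self hX
  obtain ⟨C, rfl⟩ := exists_eq_conjTranspose_mul_self hZ
  have key : ∀ Q : Matrix n n ℂ, Q.IsHermitian →
      (Q * (B.conjTranspose * B) * Q * (C.conjTranspose * C)).trace.re =
        ∑ i, ∑ j, Complex.normSq ((B * Q * C.conjTranspose) i j) := fun Q hQ => by
    rw [← trace_conjTranspose_mul_self_re]
    have h1 : Q * (B.conjTranspose * B) * Q * (C.conjTranspose * C) =
        (Q * B.conjTranspose * B * Q * C.conjTranspose) * C := by
      simp only [Matrix.mul_assoc]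
    rw [h1, Matrix.trace_mul_comm]
    simp only [Matrix.conjTranspose_mul, Matrix.conjTranspose_conjTranspose, hQ.eq,
      Matrix.mul_assoc]
  have k1 := key 1 Matrix.isHermitian_one
  rw [Matrix.one_mul, Matrix.mul_one] at k1
  have hcomm : ∑ l, ∑ i, ∑ j, Complex.normSq ((B * P l * C.conjTranspose) i j) =
      ∑ i, ∑ j, ∑ l, Complex.normSq ((B * P l * C.conjTranspose) i j) := by
    rw [Finset.sum_comm]
    exact Finset.sum_congr rfl fun i _ => Finset.sum_comm
  rw [k1, Finset.sum_congr rfl fun l _ => key (P l) (hP l), hcomm, Finset.mul_sum]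
  refine Finset.sum_le_sum fun i _ => ?_
  rw [Finset.mul_sum]
  refine Finset.sum_le_sum fun j _ => ?_
  rw [← hP1, Matrix.mul_sum, Matrix.sum_mul, Matrix.sum_apply]
  simp only [Complex.normSq_eq_norm_sq]
  refine (pow_le_pow_left₀ (norm_nonneg _) (norm_sum_le _ _) 2).trans ?_
  simpa using sq_sum_le_card_mul_sum_sq (s := Finset.univ)
    (f := fun l => ‖(B * P l * C.conjTranspose) i j‖)

end Spectral

end QRD

namespace QRD

lemma sum_le_mul_harmonic {ι : Type*} (f : ι → ℝ) (s : Finset ι) {M : ℝ}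
    (hf : ∀ i ∈ s, 0 ≤ f i)
    (h : ∀ j ∈ s, f j * ((s.filter fun i => f j ≤ f i).card : ℝ) ≤ M) :
    ∑ i ∈ s, f i ≤ M * (harmonic s.card : ℝ) := by
  induction s using Finset.induction_on_min_value f with
  | empty => simp
  | insert a s has hmin ih =>
    have h1 : ∑ i ∈ s, f i ≤ M * (harmonic s.card : ℝ) := by
      refine ih (fun i hi => hf i (Finset.mem_insert_of_mem hi)) fun j hj => ?_
      refine le_trans ?_ (h j (Finset.mem_insert_of_mem hj))
      refine mul_le_mul_of_nonneg_left ?_ (hf j (Finset.mem_insert_of_mem hj))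
      exact_mod_cast Finset.card_le_card
        (Finset.filter_subset_filter _ (Finset.subset_insert a s))
    have h2 := h a (Finset.mem_insert_self a s)
    have h3 : (insert a s).filter (fun i => f a ≤ f i) = insert a s := by
      refine Finset.filter_true_of_mem fun x hx => ?_
      rcases Finset.mem_insert.1 hx with rfl | hx
      · exact le_rfl
      · exact hmin x hx
    rw [h3, Finset.card_insert_of_notMem has] at h2
    rw [Finset.sum_insert has, Finset.card_insert_of_notMem has, harmonic_succ]
    have h4 : f a ≤ M * ((s.card + 1 : ℕ) : ℝ)⁻¹ := by
      rw [← div_eq_mul_inv, le_div_iff₀ (by positivity)]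
      exact h2
    push_cast at h4 ⊢
    linarith

/-- The weak `ℓ¹` quasinorm dominates the `ℓ¹` norm up to a logarithmic factor. -/
lemma exists_sum_le_mul_card_level {ι : Type*} [Fintype ι] [Nonempty ι] {f : ι → ℝ}
    (hf : ∀ i, 0 ≤ f i) :
    ∃ j, ∑ i, f i ≤ f j * ((Finset.univ.filter fun i => f j ≤ f i).card : ℝ) *
      (1 + Real.log (Fintype.card ι)) := by
  obtain ⟨j, hj⟩ := Finite.exists_max
    (fun j => f j * ((Finset.univ.filter fun i => f j ≤ f i).card : ℝ))
  refine ⟨j, (sum_le_mul_harmonic f Finset.univ (fun i _ => hf i) fun i _ => hj i).trans ?_⟩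
  exact mul_le_mul_of_nonneg_left (harmonic_le_one_add_log _)
    (mul_nonneg (hf j) (Nat.cast_nonneg _))

section Pinching

variable {n : Type*} [Fintype n] [DecidableEq n] {L : Type*} [Fintype L]

/-- A resolution of the identity into spectral projections `P l` of `S` (with eigenvalues `a l`)
for which the pinchings of `R` and `X` agree up to the factors `a l ^ s`. -/
structure IsPinching (P : L → Matrix n n ℂ) (R S X : Matrix n n ℂ) (a : L → ℝ) (s : ℝ) :
    Prop where
  herm : ∀ l, (P l).IsHermitian
  idem : ∀ l, P l * P l = P l
  sum_eq_one : ∑ l, P l = 1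
  nonneg : ∀ l, 0 ≤ a l
  mul_proj : ∀ l, S * P l = (a l : ℂ) • P l
  pinch : ∀ l, P l * R * P l = ((a l ^ s : ℝ) : ℂ) • (P l * X * P l)
  pinch_zero : ∀ l, a l = 0 → P l * X * P l = 0

variable {P : L → Matrix n n ℂ} {R S X : Matrix n n ℂ} {a : L → ℝ} {s : ℝ}

lemma IsPinching.posSemidef (h : IsPinching P R S X a s) {T : Matrix n n ℂ} (hT : T.PosSemidef)
    (l : L) : (P l * T * P l).PosSemidef := by
  have := hT.mul_mul_conjTranspose_same (P l)
  rwa [(h.herm l).eq] at this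

lemma IsPinching.isTest (h : IsPinching P R S X a s) {T : Matrix n n ℂ} (hT : IsTest T)
    (l : L) : IsTest (P l * T * P l) := by
  refine ⟨h.posSemidef hT.1 l, ?_⟩
  have e : 1 - P l * T * P l =
      (1 - P l) * (1 - P l).conjTranspose + P l * (1 - T) * P l := by
    rw [Matrix.conjTranspose_sub, (h.herm l).eq, Matrix.conjTranspose_one]
    simp only [Matrix.mul_sub, Matrix.sub_mul, Matrix.one_mul, Matrix.mul_one, h.idem l]
    abel
  rw [e]
  exact (Matrix.posSemidef_self_mul_conjTranspose _).add (h.posSemidef hT.2 l)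

lemma nonneg_of_posSemidef_conjDiag {V : Matrix n n ℂ} (hV : V ∈ Matrix.unitaryGroup n ℂ)
    {t : n → ℝ} (h : (conjDiag V t).PosSemidef) (i : n) : 0 ≤ t i := by
  have h1 := h.conjTranspose_mul_mul_same V
  have hV' : V.conjTranspose * V = 1 := (Matrix.mem_unitaryGroup_iff').1 hV
  have e : V.conjTranspose * conjDiag V t * V = Matrix.diagonal (fun i => (t i : ℂ)) := by
    have : V.conjTranspose * conjDiag V t * V =
        (V.conjTranspose * V) * Matrix.diagonal (fun i => (t i : ℂ)) * (V.conjTranspose * V) := by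
      simp only [conjDiag, Matrix.mul_assoc, Matrix.star_eq_conjTranspose]
    rw [this, hV', Matrix.one_mul, Matrix.mul_one]
  rw [e, Matrix.posSemidef_diagonal_iff] at h1
  simpa using h1 i

lemma exists_conjDiag_of_isTest {T : Matrix n n ℂ} (hT : IsTest T) :
    ∃ V ∈ Matrix.unitaryGroup n ℂ, ∃ t : n → ℝ, (∀ i, 0 ≤ t i) ∧ (∀ i, t i ≤ 1) ∧
      T = conjDiag V t := by
  obtain ⟨V, hV, t, ht, rfl⟩ := exists_conjDiag hT.1
  refine ⟨V, hV, t, ht, fun i => ?_, rfl⟩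
  have h := hT.2
  rw [← conjDiag_one hV, conjDiag_sub] at h
  exact sub_nonneg.1 (nonneg_of_posSemidef_conjDiag hV h i)

lemma isTest_conjDiag {V : Matrix n n ℂ} (hV : V ∈ Matrix.unitaryGroup n ℂ) {t : n → ℝ}
    (h0 : ∀ i, 0 ≤ t i) (h1 : ∀ i, t i ≤ 1) : IsTest (conjDiag V t) := by
  refine ⟨posSemidef_conjDiag V h0, ?_⟩
  rw [← conjDiag_one hV, conjDiag_sub]
  exact posSemidef_conjDiag V fun i => sub_nonneg.2 (h1 i)

lemma IsPinching.trace_mul_le (h : IsPinching P R S X a s) {T : Matrix n n ℂ}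
    (hT : T.PosSemidef) (l : L) :
    a l * (P l * T * P l).trace.re ≤ (S * T).trace.re := by
  have h1 : ∀ l, (S * P l * T).trace.re = a l * (P l * T * P l).trace.re := fun l => by
    have e : (P l * T * P l).trace = (P l * T).trace := by
      rw [Matrix.trace_mul_comm, ← Matrix.mul_assoc, h.idem]
    rw [e, h.mul_proj, Matrix.smul_mul, Matrix.trace_smul, smul_eq_mul, Complex.re_ofReal_mul]
  have h2 : S * T = ∑ l, S * P l * T := by
    rw [← Matrix.sum_mul, ← Matrix.mul_sum, h.sum_eq_one, Matrix.mul_one]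
  rw [h2, Matrix.trace_sum, Complex.re_sum, Finset.sum_congr rfl fun l _ => h1 l]
  exact Finset.single_le_sum (f := fun l => a l * (P l * T * P l).trace.re)
    (fun i _ => mul_nonneg (h.nonneg i) (Complex.nonneg_iff.1 (h.posSemidef hT i).trace_nonneg).1)
    (Finset.mem_univ l)

/-- Upper bound on the success probability of any test. -/
lemma IsPinching.trace_mul_test_le {U : Matrix n n ℂ} {x : n → ℝ} {p q : ℝ}
    (h : IsPinching P R S (conjDiag U x) a (1 / q)) (hpq : p.HolderConjugate q)
    (hU : U ∈ Matrix.unitaryGroup n ℂ) (hx : ∀ i, 0 ≤ x i)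
    (hR : R.PosSemidef) {T : Matrix n n ℂ} (hT : IsTest T) :
    (R * T).trace.re ≤
      (Fintype.card L : ℝ) ^ 2 * ((∑ i, x i ^ p) ^ (1 / p) * (S * T).trace.re ^ (1 / q)) := by
  have hq := hpq.symm.pos
  refine (trace_mul_le_pinching h.herm h.sum_eq_one hR hT.1).trans ?_
  rw [pow_two, mul_assoc]
  refine mul_le_mul_of_nonneg_left ?_ (Nat.cast_nonneg _)
  rw [← nsmul_eq_mul]
  refine Finset.sum_le_card_nsmul _ _ _ fun l _ => ?_
  obtain ⟨V, hV, t, ht0, ht1, hPT⟩ := exists_conjDiag_of_isTest (h.isTest hT l)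
  have e1 : (P l * conjDiag U x * P l * T).trace.re = (conjDiag U x * conjDiag V t).trace.re := by
    rw [← hPT, Matrix.mul_assoc, Matrix.mul_assoc, Matrix.trace_mul_comm]
    simp only [Matrix.mul_assoc]
  rw [h.pinch, Matrix.smul_mul, Matrix.trace_smul, smul_eq_mul, Complex.re_ofReal_mul, e1]
  have e2 := trace_mul_le_holder hU hV hx ht0 hpq
  have e3 : ∑ i, t i ^ q ≤ ∑ i, t i := Finset.sum_le_sum fun i _ => by
    simpa using Real.rpow_le_rpow_of_exponent_ge' (ht0 i) (ht1 i) zero_le_one hpq.symm.lt.le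
  have e4 : a l * ∑ i, t i ≤ (S * T).trace.re := by
    have := h.trace_mul_le hT.1 l
    rwa [hPT, trace_conjDiag hV, Complex.ofReal_re] at this
  have hs : 0 ≤ ∑ i, t i := Finset.sum_nonneg fun i _ => ht0 i
  have hA : 0 ≤ (∑ i, x i ^ p) ^ (1 / p) :=
    Real.rpow_nonneg (Finset.sum_nonneg fun i _ => Real.rpow_nonneg (hx i) _) _
  calc a l ^ (1 / q) * (conjDiag U x * conjDiag V t).trace.re
      ≤ a l ^ (1 / q) * ((∑ i, x i ^ p) ^ (1 / p) * (∑ i, t i) ^ (1 / q)) := by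
        refine mul_le_mul_of_nonneg_left (e2.trans ?_) (Real.rpow_nonneg (h.nonneg l) _)
        refine mul_le_mul_of_nonneg_left ?_ hA
        exact Real.rpow_le_rpow (Finset.sum_nonneg fun i _ => Real.rpow_nonneg (ht0 i) _) e3
          (by positivity)
    _ = (∑ i, x i ^ p) ^ (1 / p) * (a l * ∑ i, t i) ^ (1 / q) := by
        rw [Real.mul_rpow (h.nonneg l) hs]; ring
    _ ≤ _ := mul_le_mul_of_nonneg_left
        (Real.rpow_le_rpow (mul_nonneg (h.nonneg l) hs) e4 (by positivity)) hA

/-- Existence of a single block of the pinching which carries most of the Schatten norm. -/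
lemma IsPinching.exists_block {U : Matrix n n ℂ} {x : n → ℝ} {p q : ℝ}
    (h : IsPinching P R S (conjDiag U x) a (1 / q)) (hpq : p.HolderConjugate q)
    (hU : U ∈ Matrix.unitaryGroup n ℂ) (hx : ∀ i, 0 ≤ x i) (hpos : 0 < ∑ i, x i ^ p) :
    ∃ l, ∃ V ∈ Matrix.unitaryGroup n ℂ, ∃ y : n → ℝ, (∀ i, 0 ≤ y i) ∧
      P l * conjDiag U x * P l = conjDiag V y ∧
      (∑ i, x i ^ p) ^ (1 / p) ≤ (Fintype.card L : ℝ) ^ 2 * (∑ i, y i ^ p) ^ (1 / p) := by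
  have hp := hpq.pos
  have hX := posSemidef_conjDiag U hx
  choose V hV y hy hVy using fun l => exists_conjDiag (h.posSemidef hX l)
  set A := ∑ i, x i ^ p with hA
  have hz : ∀ i, 0 ≤ x i ^ (p - 1) := fun i => Real.rpow_nonneg (hx i) _
  have e1 : (conjDiag U x * conjDiag U fun i => x i ^ (p - 1)).trace.re = A := by
    rw [conjDiag_mul hU, trace_conjDiag hU, Complex.ofReal_re]
    refine Finset.sum_congr rfl fun i _ => ?_
    rcases (hx i).eq_or_lt with h0 | h0
    · rw [← h0, zero_mul, Real.zero_rpow hp.ne']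
    · rw [← Real.rpow_one_add' h0.le (by linarith), add_sub_cancel]
  have e2 := trace_mul_le_pinching h.herm h.sum_eq_one hX (posSemidef_conjDiag U hz)
  rw [e1] at e2
  have e3 : ∀ l, (P l * conjDiag U x * P l * conjDiag U fun i => x i ^ (p - 1)).trace.re ≤
      (∑ i, y l i ^ p) ^ (1 / p) * A ^ (1 / q) := fun l => by
    rw [hVy l]
    refine (trace_mul_le_holder (hV l) hU (hy l) hz hpq).trans (le_of_eq ?_)
    congr 2
    refine Finset.sum_congr rfl fun i _ => ?_
    rw [← Real.rpow_mul (hx i), hpq.sub_one_mul_conj]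
  have e4 : A ≤ Fintype.card L * ∑ l, (∑ i, y l i ^ p) ^ (1 / p) * A ^ (1 / q) :=
    e2.trans (mul_le_mul_of_nonneg_left (Finset.sum_le_sum fun l _ => e3 l) (Nat.cast_nonneg _))
  have hAA : A = A ^ (1 / p) * A ^ (1 / q) := by
    have hs : 1 / p + 1 / q = 1 := by simpa [one_div] using hpq.inv_add_inv_eq_one
    rw [← Real.rpow_add hpos, hs, Real.rpow_one]
  have hAq : 0 < A ^ (1 / q) := Real.rpow_pos_of_pos hpos _
  have e5 : A ^ (1 / p) ≤ Fintype.card L * ∑ l, (∑ i, y l i ^ p) ^ (1 / p) := by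
    rw [← Finset.sum_mul, ← mul_assoc] at e4
    refine le_of_mul_le_mul_right ?_ hAq
    rwa [← hAA]
  by_contra hcon
  push Not at hcon
  have e6 : ∀ l, (Fintype.card L : ℝ) ^ 2 * (∑ i, y l i ^ p) ^ (1 / p) < A ^ (1 / p) :=
    fun l => hcon l (V l) (hV l) (y l) (hy l) (hVy l)
  have hL : (Finset.univ : Finset L).Nonempty := by
    rw [Finset.nonempty_iff_ne_empty]
    intro h0
    rw [h0] at e5
    have := Real.rpow_pos_of_pos hpos (1 / p)
    simp at e5
    simp at this
    linarith
  have hcard : (0 : ℝ) < Fintype.card L := by exact_mod_cast Finset.card_pos.2 hL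
  have e7 := Finset.sum_lt_sum_of_nonempty hL fun l _ => e6 l
  rw [← Finset.mul_sum, Finset.sum_const, nsmul_eq_mul, Finset.card_univ, pow_two, mul_assoc] at e7
  exact absurd (lt_of_mul_lt_mul_left e7 hcard.le) (not_lt.2 e5)

/-- Existence of a test saturating the upper bound up to the size of the pinching and a
logarithmic factor. -/
lemma IsPinching.exists_test {U : Matrix n n ℂ} {x : n → ℝ} {p q : ℝ}
    (h : IsPinching P R S (conjDiag U x) a (1 / q)) (hpq : p.HolderConjugate q)
    (hU : U ∈ Matrix.unitaryGroup n ℂ) (hx : ∀ i, 0 ≤ x i) (hpos : 0 < ∑ i, x i ^ p) :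
    ∃ T, IsTest T ∧ 0 < (S * T).trace.re ∧
      (∑ i, x i ^ p) ^ (1 / p) * (S * T).trace.re ^ (1 / q) ≤
        (Fintype.card L : ℝ) ^ 2 * (1 + Real.log (Fintype.card n)) * (R * T).trace.re := by
  have hp := hpq.pos
  obtain ⟨l, V, hV, y, hy, hVy, hle⟩ := h.exists_block hpq hU hx hpos
  have hn : Nonempty n := by
    by_contra hn
    rw [not_nonempty_iff] at hn
    simp at hpos
  obtain ⟨j, hj⟩ := exists_sum_le_mul_card_level (f := fun i => y i ^ p)
    fun i => Real.rpow_nonneg (hy i) p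
  have hfil : (Finset.univ.filter fun i => y j ^ p ≤ y i ^ p) =
      Finset.univ.filter fun i => y j ≤ y i :=
    Finset.filter_congr fun i _ => Real.rpow_le_rpow_iff (hy j) (hy i) hp
  rw [hfil] at hj
  set F := Finset.univ.filter fun i => y j ≤ y i with hF
  have hA := Real.rpow_pos_of_pos hpos (1 / p)
  have hB : 0 < ∑ i, y i ^ p := by
    refine lt_of_le_of_ne (Finset.sum_nonneg fun i _ => Real.rpow_nonneg (hy i) p) fun h0 => ?_
    rw [← h0, Real.zero_rpow (by positivity), mul_zero] at hle
    linarith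
  have hlog : 0 ≤ Real.log (Fintype.card n) := Real.log_natCast_nonneg _
  have hyj : 0 < y j := by
    refine lt_of_le_of_ne (hy j) fun h0 => ?_
    rw [← h0, Real.zero_rpow hp.ne', zero_mul, zero_mul] at hj
    linarith
  have hk : (0 : ℝ) < F.card := by
    have : j ∈ F := by simp [hF]
    exact_mod_cast Finset.card_pos.2 ⟨j, this⟩
  let t : n → ℝ := fun i => if y j ≤ y i then 1 else 0
  have ht0 : ∀ i, 0 ≤ t i := fun i => by dsimp [t]; split_ifs <;> norm_num
  have ht1 : ∀ i, t i ≤ 1 := fun i => by dsimp [t]; split_ifs <;> norm_num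
  have hPT : P l * conjDiag V t = conjDiag V t := by
    have e : conjDiag V t = P l * conjDiag U x * P l * conjDiag V (fun i => t i / y i) := by
      rw [hVy, conjDiag_mul hV]
      congr 1
      funext i
      dsimp [t]
      split_ifs with hi
      · rw [mul_div_cancel₀ _ (hyj.trans_le hi).ne']
      · simp
    rw [e]
    simp only [← Matrix.mul_assoc, h.idem]
  have hTP : conjDiag V t * P l = conjDiag V t := by
    have := congrArg Matrix.conjTranspose hPT
    rwa [Matrix.conjTranspose_mul, (h.herm l).eq, (isHermitian_conjDiag V t).eq] at this
  have hsum : ∑ i, t i = F.card := by simp [t, hF]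
  have hST : (S * conjDiag V t).trace.re = a l * F.card := by
    rw [← hPT, ← Matrix.mul_assoc, h.mul_proj, Matrix.smul_mul, hPT, Matrix.trace_smul,
      smul_eq_mul, Complex.re_ofReal_mul, trace_conjDiag hV, Complex.ofReal_re, hsum]
  have hYT : F.card * y j ≤ (conjDiag V y * conjDiag V t).trace.re := by
    rw [conjDiag_mul hV, trace_conjDiag hV, Complex.ofReal_re]
    have : ∑ i, y i * t i = ∑ i ∈ F, y i := by
      rw [hF, Finset.sum_filter]
      refine Finset.sum_congr rfl fun i _ => ?_
      dsimp [t]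
      split_ifs <;> simp
    rw [this, ← nsmul_eq_mul]
    exact Finset.card_nsmul_le_sum _ _ _ fun i hi => (Finset.mem_filter.1 hi).2
  have hRT : (R * conjDiag V t).trace.re =
      a l ^ (1 / q) * (conjDiag V y * conjDiag V t).trace.re := by
    have e : (P l * R * P l * conjDiag V t).trace = (R * conjDiag V t).trace := by
      rw [Matrix.mul_assoc, hPT, Matrix.mul_assoc, Matrix.trace_mul_comm, Matrix.mul_assoc, hTP]
    rw [← e, h.pinch, hVy, Matrix.smul_mul, Matrix.trace_smul, smul_eq_mul, Complex.re_ofReal_mul]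
  have ha : 0 < a l := by
    refine lt_of_le_of_ne (h.nonneg l) fun h0 => ?_
    rw [← hVy, h.pinch_zero l h0.symm, Matrix.zero_mul, Matrix.trace_zero, Complex.zero_re] at hYT
    exact absurd hYT (not_le.2 (mul_pos hk hyj))
  refine ⟨conjDiag V t, isTest_conjDiag hV ht0 ht1, by rw [hST]; positivity, ?_⟩
  have hroot : (∑ i, y i ^ p) ^ (1 / p) ≤
      y j * (F.card : ℝ) ^ (1 / p) * (1 + Real.log (Fintype.card n)) := by
    refine (Real.rpow_le_rpow hB.le hj (by positivity)).trans ?_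
    have hyp := Real.rpow_pos_of_pos hyj p
    rw [Real.mul_rpow (by positivity) (by positivity), Real.mul_rpow hyp.le hk.le,
      ← Real.rpow_mul hyj.le, mul_one_div_cancel hp.ne', Real.rpow_one]
    refine mul_le_mul_of_nonneg_left ?_ (by positivity)
    calc (1 + Real.log (Fintype.card n)) ^ (1 / p)
        ≤ (1 + Real.log (Fintype.card n)) ^ (1 : ℝ) :=
          Real.rpow_le_rpow_of_exponent_le (by linarith)
            ((div_le_one hp).2 hpq.lt.le)
      _ = _ := Real.rpow_one _
  have hkk : (F.card : ℝ) ^ (1 / p) * (F.card : ℝ) ^ (1 / q) = F.card := by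
    have hs : 1 / p + 1 / q = 1 := by simpa [one_div] using hpq.inv_add_inv_eq_one
    rw [← Real.rpow_add hk, hs, Real.rpow_one]
  have haq := Real.rpow_pos_of_pos ha (1 / q)
  have hkq := Real.rpow_pos_of_pos hk (1 / q)
  rw [hST, hRT, Real.mul_rpow ha.le hk.le]
  set H := 1 + Real.log (Fintype.card n) with hH
  have hH0 : 0 < H := by rw [hH]; linarith
  calc (∑ i, x i ^ p) ^ (1 / p) * (a l ^ (1 / q) * (F.card : ℝ) ^ (1 / q))
      ≤ (Fintype.card L : ℝ) ^ 2 * (y j * (F.card : ℝ) ^ (1 / p) * H) *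
          (a l ^ (1 / q) * (F.card : ℝ) ^ (1 / q)) := by
        refine mul_le_mul_of_nonneg_right (hle.trans ?_) (by positivity)
        exact mul_le_mul_of_nonneg_left hroot (by positivity)
    _ = (Fintype.card L : ℝ) ^ 2 * H * (a l ^ (1 / q) *
          (((F.card : ℝ) ^ (1 / p) * (F.card : ℝ) ^ (1 / q)) * y j)) := by ring
    _ ≤ _ := by
        rw [hkk]
        refine mul_le_mul_of_nonneg_left ?_ (by positivity)
        exact mul_le_mul_of_nonneg_left hYT haq.le

end Pinching

end QRD

namespace QRD

lemma conjDiag_const_mul {n : Type*} [Fintype n] [DecidableEq n] (U : Matrix n n ℂ) (c : ℝ)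
    (a : n → ℝ) : conjDiag U (fun i => c * a i) = (c : ℂ) • conjDiag U a := by
  have h : Matrix.diagonal (fun i => ((c * a i : ℝ) : ℂ)) =
      (c : ℂ) • Matrix.diagonal (fun i => (a i : ℂ)) := by
    rw [← Matrix.diagonal_smul]
    congr 1
    funext i
    simp
  rw [conjDiag, h, Matrix.mul_smul, Matrix.smul_mul]
  rfl

section TensorPow

variable {d : ℕ}

lemma tensorPow_mul (A B : Matrix (Fin d) (Fin d) ℂ) (N : ℕ) :
    tensorPow (A * B) N = tensorPow A N * tensorPow B N := by
  ext x y
  simp only [tensorPow, Matrix.of_apply, Matrix.mul_apply, Finset.prod_univ_sum,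
    Fintype.piFinset_univ, Finset.prod_mul_distrib]

lemma tensorPow_star (A : Matrix (Fin d) (Fin d) ℂ) (N : ℕ) :
    tensorPow (star A) N = star (tensorPow A N) := by
  ext x y
  simp [tensorPow, Matrix.star_apply]

lemma tensorPow_diagonal (a : Fin d → ℂ) (N : ℕ) :
    tensorPow (Matrix.diagonal a) N = Matrix.diagonal fun x => ∏ i, a (x i) := by
  ext x y
  simp only [tensorPow, Matrix.of_apply, Matrix.diagonal_apply]
  split_ifs with h
  · subst h; simp
  · obtain ⟨i, hi⟩ := Function.ne_iff.1 h
    exact Finset.prod_eq_zero (Finset.mem_univ i) (if_neg hi)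

lemma tensorPow_one (N : ℕ) : tensorPow (1 : Matrix (Fin d) (Fin d) ℂ) N = 1 := by
  rw [← Matrix.diagonal_one, tensorPow_diagonal]
  simp

lemma tensorPow_conjDiag (U : Matrix (Fin d) (Fin d) ℂ) (a : Fin d → ℝ) (N : ℕ) :
    tensorPow (conjDiag U a) N = conjDiag (tensorPow U N) fun x => ∏ i, a (x i) := by
  simp only [conjDiag, tensorPow_mul, tensorPow_star, tensorPow_diagonal, Complex.ofReal_prod]

lemma tensorPow_mem_unitaryGroup {U : Matrix (Fin d) (Fin d) ℂ}
    (hU : U ∈ Matrix.unitaryGroup (Fin d) ℂ) (N : ℕ) :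
    tensorPow U N ∈ Matrix.unitaryGroup (Fin N → Fin d) ℂ := by
  rw [Matrix.mem_unitaryGroup_iff, ← tensorPow_star, ← tensorPow_mul,
    (Matrix.mem_unitaryGroup_iff).1 hU, tensorPow_one]

lemma posSemidef_tensorPow {A : Matrix (Fin d) (Fin d) ℂ} (hA : A.PosSemidef) (N : ℕ) :
    (tensorPow A N).PosSemidef := by
  obtain ⟨U, -, a, ha, rfl⟩ := exists_conjDiag hA
  rw [tensorPow_conjDiag]
  exact posSemidef_conjDiag _ fun x => Finset.prod_nonneg fun i _ => ha _

lemma trace_tensorPow (A : Matrix (Fin d) (Fin d) ℂ) (N : ℕ) :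
    (tensorPow A N).trace = A.trace ^ N := by
  simp only [Matrix.trace, Matrix.diag_apply, tensorPow, Matrix.of_apply, Fintype.sum_pow]

/-- The type (number of occurrences of each letter) of a word. -/
def wordType {N : ℕ} (x : Fin N → Fin d) : Fin d → Fin (N + 1) := fun k =>
  ⟨(Finset.univ.filter fun i => x i = k).card,
    Nat.lt_succ_of_le ((Finset.card_le_univ _).trans_eq (Fintype.card_fin N))⟩

lemma prod_eq_prod_pow_wordType {N : ℕ} (x : Fin N → Fin d) (f : Fin d → ℝ) :
    ∏ i, f (x i) = ∏ k, f k ^ (wordType x k : ℕ) := by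
  rw [← Finset.prod_fiberwise_of_maps_to (g := x) (t := Finset.univ) (fun _ _ => Finset.mem_univ _)]
  refine Finset.prod_congr rfl fun k _ => ?_
  rw [Finset.prod_congr rfl fun i hi => by rw [(Finset.mem_filter.1 hi).2], Finset.prod_const]
  rfl

/-- The projection onto the type class of `l` in the product basis given by the columns of `U`. -/
noncomputable def typeProj (U : Matrix (Fin d) (Fin d) ℂ) (N : ℕ) (l : Fin d → Fin (N + 1)) :
    Matrix (Fin N → Fin d) (Fin N → Fin d) ℂ :=
  conjDiag (tensorPow U N) fun x => if wordType x = l then 1 else 0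

lemma tensorPow_conjDiag_mul_typeProj {U : Matrix (Fin d) (Fin d) ℂ}
    (hU : U ∈ Matrix.unitaryGroup (Fin d) ℂ) (f : Fin d → ℝ) (N : ℕ) (l : Fin d → Fin (N + 1)) :
    tensorPow (conjDiag U f) N * typeProj U N l =
      ((∏ k, f k ^ (l k : ℕ) : ℝ) : ℂ) • typeProj U N l := by
  rw [tensorPow_conjDiag, typeProj, conjDiag_mul (tensorPow_mem_unitaryGroup hU N),
    ← conjDiag_const_mul]
  congr 1
  funext x
  rw [prod_eq_prod_pow_wordType]
  split_ifs with h
  · rw [h]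
  · simp

lemma sum_typeProj {U : Matrix (Fin d) (Fin d) ℂ}
    (hU : U ∈ Matrix.unitaryGroup (Fin d) ℂ) (N : ℕ) : ∑ l, typeProj U N l = 1 := by
  rw [← conjDiag_one (tensorPow_mem_unitaryGroup hU N)]
  simp only [typeProj, conjDiag, ← Matrix.sum_mul, ← Matrix.mul_sum]
  congr 2
  ext x y
  rw [Matrix.sum_apply]
  by_cases h : x = y
  · subst h
    simp only [Matrix.diagonal_apply_eq]
    exact_mod_cast (by simp : ∑ l, (if wordType x = l then (1 : ℝ) else 0) = 1)
  · simp [Matrix.diagonal_apply_ne _ h]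

lemma mul_eq_zero_of_suppLE {ρ σ : Matrix (Fin d) (Fin d) ℂ} (h : suppLE ρ σ)
    {B : Matrix (Fin d) (Fin d) ℂ} (hB : σ * B = 0) : ρ * B = 0 := by
  ext i j
  have h1 : (fun k => B k j) ∈ LinearMap.ker σ.mulVecLin := by
    rw [LinearMap.mem_ker, Matrix.mulVecLin_apply]
    funext i
    exact congrFun (congrFun hB i) j
  have h2 := h h1
  rw [LinearMap.mem_ker, Matrix.mulVecLin_apply] at h2
  exact congrFun h2 i

lemma isPinching_typeProj {ρ : Matrix (Fin d) (Fin d) ℂ} {U : Matrix (Fin d) (Fin d) ℂ}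
    (hU : U ∈ Matrix.unitaryGroup (Fin d) ℂ) {μ : Fin d → ℝ} (hμ : ∀ k, 0 ≤ μ k)
    (hsupp : suppLE ρ (conjDiag U μ)) {s t : ℝ} (hs : 0 < s) (hst : t + t = -s) (N : ℕ) :
    IsPinching (typeProj U N) (tensorPow ρ N) (tensorPow (conjDiag U μ) N)
      (tensorPow (conjDiag U (fun k => if μ k = 0 then 0 else μ k ^ t) * ρ *
        conjDiag U (fun k => if μ k = 0 then 0 else μ k ^ t)) N)
      (fun l => ∏ k, μ k ^ (l k : ℕ)) s := by
  set g : Fin d → ℝ := fun k => if μ k = 0 then 0 else μ k ^ t with hg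
  have hW := tensorPow_mem_unitaryGroup hU N
  have hherm : ∀ l, (typeProj U N l).IsHermitian := fun l => isHermitian_conjDiag _ _
  have hX : ∀ l, typeProj U N l * tensorPow (conjDiag U g * ρ * conjDiag U g) N * typeProj U N l =
      (((∏ k, g k ^ (l k : ℕ)) * ∏ k, g k ^ (l k : ℕ) : ℝ) : ℂ) •
        (typeProj U N l * tensorPow ρ N * typeProj U N l) := fun l => by
    have e1 := tensorPow_conjDiag_mul_typeProj hU g N l
    have e2 := congrArg Matrix.conjTranspose e1
    rw [Matrix.conjTranspose_mul, (hherm l).eq, tensorPow_conjDiag, (isHermitian_conjDiag _ _).eq,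
      ← tensorPow_conjDiag, Matrix.conjTranspose_smul, (hherm l).eq, Complex.star_def,
      Complex.conj_ofReal] at e2
    rw [tensorPow_mul, tensorPow_mul, ← Matrix.mul_assoc, ← Matrix.mul_assoc, e2, Matrix.mul_assoc,
      e1]
    simp only [Matrix.smul_mul, Matrix.mul_smul, smul_smul, Complex.ofReal_mul]
  have hzero : ∀ l : Fin d → Fin (N + 1), ∏ k, μ k ^ (l k : ℕ) = 0 →
      ∀ f : Fin d → ℝ, (∀ k, μ k = 0 → f k = 0) → ∏ k, f k ^ (l k : ℕ) = 0 := fun l hl f hf => by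
    obtain ⟨k, -, hk⟩ := Finset.prod_eq_zero_iff.1 hl
    refine Finset.prod_eq_zero (Finset.mem_univ k) ?_
    rw [hf k (eq_zero_of_pow_eq_zero hk)]
    refine zero_pow fun h0 => ?_
    rw [h0, pow_zero] at hk
    exact one_ne_zero hk
  refine ⟨hherm, fun l => ?_, sum_typeProj hU N, fun l => Finset.prod_nonneg fun k _ =>
    pow_nonneg (hμ k) _, fun l => tensorPow_conjDiag_mul_typeProj hU μ N l, fun l => ?_,
    fun l hl => ?_⟩
  · rw [typeProj, conjDiag_mul hW]
    congr 1
    funext x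
    split_ifs <;> simp
  · by_cases hl : ∏ k, μ k ^ (l k : ℕ) = 0
    · have hρ : ρ * conjDiag U (fun k => if μ k = 0 then 0 else 1) = ρ := by
        have h1 : ρ * (1 - conjDiag U (fun k => if μ k = 0 then 0 else 1)) = 0 := by
          refine mul_eq_zero_of_suppLE hsupp ?_
          rw [← conjDiag_one hU, conjDiag_sub, conjDiag_mul hU]
          have : (fun k => μ k * (1 - if μ k = 0 then (0 : ℝ) else 1)) = fun _ => 0 := by
            funext k
            split_ifs with h <;> simp [h]
          rw [this]
          simp [conjDiag]
        rw [Matrix.mul_sub, Matrix.mul_one, sub_eq_zero] at h1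
        exact h1.symm
      have h2 : tensorPow ρ N * typeProj U N l = 0 := by
        rw [← hρ, tensorPow_mul, Matrix.mul_assoc, tensorPow_conjDiag_mul_typeProj hU,
          hzero l hl _ fun k hk => if_pos hk]
        simp
      rw [Matrix.mul_assoc, h2, Matrix.mul_zero, hl, Real.zero_rpow hs.ne']
      simp
    · rw [hX, smul_smul, ← Complex.ofReal_mul]
      have : (∏ k, μ k ^ (l k : ℕ)) ^ s * ((∏ k, g k ^ (l k : ℕ)) * ∏ k, g k ^ (l k : ℕ)) = 1 := by
        rw [← Real.finsetProd_rpow _ _ fun k _ => pow_nonneg (hμ k) _, ← Finset.prod_mul_distrib,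
          ← Finset.prod_mul_distrib]
        refine Finset.prod_eq_one fun k _ => ?_
        have hk := Finset.prod_ne_zero_iff.1 hl k (Finset.mem_univ k)
        by_cases h0 : μ k = 0
        · have : (l k : ℕ) = 0 := by
            by_contra h
            exact hk (by rw [h0, zero_pow h])
          simp [this]
        · have hpos : 0 < μ k := (hμ k).lt_of_ne' h0
          rw [hg]
          simp only [if_neg h0]
          rw [← mul_pow, ← Real.rpow_add hpos, hst, ← Real.rpow_natCast, ← Real.rpow_mul hpos.le,
            mul_comm _ s, Real.rpow_mul hpos.le, Real.rpow_natCast, ← mul_pow,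
            ← Real.rpow_add hpos, add_neg_cancel, Real.rpow_zero, one_pow]
      rw [this]
      simp
  · rw [hX, hzero l hl g fun k hk => if_pos hk]
    simp

end TensorPow

lemma isTest_one {m : Type*} [Fintype m] [DecidableEq m] : IsTest (1 : Matrix m m ℂ) :=
  ⟨Matrix.PosSemidef.one, by rw [sub_self]; exact Matrix.PosSemidef.zero⟩

/-- Two-sided bounds, up to polynomial factors, relating the test probabilities to the sandwiched
Rényi divergence, where `Λ = ((α - 1) / α) D*_α(ρ‖σ)`. -/
lemma exists_rate_bounds {d : ℕ} {ρ σ : Matrix (Fin d) (Fin d) ℂ}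
    (hρ : IsDensityMatrix ρ) (hσ : IsDensityMatrix σ) (hsupp : suppLE ρ σ) {α : ℝ} (hα : 1 < α) :
    ∃ Λ : ℝ,
      (∀ r : ℝ, ((((α - 1) / α : ℝ) : EReal) * ((r : EReal) - Dstar α ρ σ)) =
        (((α - 1) / α * r - Λ : ℝ) : EReal)) ∧
      (∀ (N : ℕ) T, IsTest T → (tensorPow ρ N * T).trace.re ≤
        ((N : ℝ) + 1) ^ (2 * d) *
          (Real.exp (N * Λ) * (tensorPow σ N * T).trace.re ^ ((α - 1) / α))) ∧
      (∀ N : ℕ, ∃ T, IsTest T ∧ 0 < (tensorPow σ N * T).trace.re ∧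
        Real.exp (N * Λ) * (tensorPow σ N * T).trace.re ^ ((α - 1) / α) ≤
          ((N : ℝ) + 1) ^ (2 * d) * (1 + N * Real.log d) * (tensorPow ρ N * T).trace.re) := by
  have hα0 : 0 < α := by linarith
  have hpq : α.HolderConjugate (Real.conjExponent α) := Real.HolderConjugate.conjExponent hα
  have hs : (α - 1) / α = 1 / Real.conjExponent α := by
    rw [Real.conjExponent, one_div_div]
  have hs0 : 0 < (α - 1) / α := div_pos (by linarith) hα0
  have ht : (1 - α) / (2 * α) + (1 - α) / (2 * α) = -((α - 1) / α) := by field_simp; ring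
  have hU := (hσ.1.1.eigenvectorUnitary).2
  have hμ := hσ.1.eigenvalues_nonneg
  have hσe := eq_conjDiag_eigenvalues hσ.1.1
  have hPow : matPow σ ((1 - α) / (2 * α)) =
      conjDiag (hσ.1.1.eigenvectorUnitary : Matrix (Fin d) (Fin d) ℂ)
        (fun k => if hσ.1.1.eigenvalues k = 0 then 0
          else hσ.1.1.eigenvalues k ^ ((1 - α) / (2 * α))) := matFun_eq_conjDiag hσ.1.1 _
  have hpin := isPinching_typeProj (ρ := ρ) hU hμ (by rw [← hσe]; exact hsupp) hs0 ht
  rw [← hPow, ← hσe] at hpin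
  set X := matPow σ ((1 - α) / (2 * α)) * ρ * matPow σ ((1 - α) / (2 * α)) with hXdef
  have hX : X.PosSemidef := by
    have := hρ.1.mul_mul_conjTranspose_same (matPow σ ((1 - α) / (2 * α)))
    rwa [hPow, (isHermitian_conjDiag _ _).eq, ← hPow] at this
  have hV := (hX.1.eigenvectorUnitary).2
  have hx := hX.eigenvalues_nonneg
  have hXe := eq_conjDiag_eigenvalues hX.1
  have hQ : (matPow X α).trace.re = ∑ i, hX.1.eigenvalues i ^ α := by
    rw [matPow, matFun_eq_conjDiag hX.1, trace_conjDiag hV, Complex.ofReal_re]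
    refine Finset.sum_congr rfl fun i _ => ?_
    split_ifs with h
    · rw [h, Real.zero_rpow hα0.ne']
    · rfl
  set x := hX.1.eigenvalues
  set V : Matrix (Fin d) (Fin d) ℂ := (hX.1.eigenvectorUnitary : Matrix (Fin d) (Fin d) ℂ)
  rw [hs, hXe] at hpin
  simp only [tensorPow_conjDiag V] at hpin
  have hx' : ∀ N, ∀ w : Fin N → Fin d, 0 ≤ ∏ i, x (w i) := fun N w =>
    Finset.prod_nonneg fun i _ => hx _
  have hsum : ∀ N, ∑ w : Fin N → Fin d, (∏ i, x (w i)) ^ α = (∑ i, x i ^ α) ^ N := fun N => by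
    rw [Fintype.sum_pow]
    exact Finset.sum_congr rfl fun w _ => (Real.finsetProd_rpow _ _ (fun i _ => hx _) _).symm
  have hcard : ∀ N : ℕ, (Fintype.card (Fin d → Fin (N + 1)) : ℝ) ^ 2 = ((N : ℝ) + 1) ^ (2 * d) :=
    fun N => by
      rw [Fintype.card_fun, Fintype.card_fin, Fintype.card_fin]
      push_cast
      rw [← pow_mul, mul_comm]
  have hC := fun N T hT => (hpin N).trace_mul_test_le hpq (tensorPow_mem_unitaryGroup hV N)
    (hx' N) (posSemidef_tensorPow hρ.1 N) (T := T) hT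
  simp only [hsum, hcard, ← hs] at hC
  have hQpos : 0 < ∑ i, x i ^ α := by
    refine lt_of_le_of_ne (Finset.sum_nonneg fun i _ => Real.rpow_nonneg (hx i) _) fun h0 => ?_
    have := hC 1 1 isTest_one
    rw [Matrix.mul_one, trace_tensorPow, hρ.2, ← h0, pow_one, pow_one, Complex.one_re,
      Real.zero_rpow (by positivity), zero_mul, mul_zero] at this
    linarith
  have hexp : ∀ N : ℕ, ((∑ i, x i ^ α) ^ N) ^ (1 / α) =
      Real.exp (N * (Real.log (∑ i, x i ^ α) / α)) := fun N => by
    rw [Real.rpow_def_of_pos (pow_pos hQpos N), Real.log_pow]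
    congr 1
    ring
  refine ⟨Real.log (∑ i, x i ^ α) / α, fun r => ?_, fun N T hT => ?_, fun N => ?_⟩
  · rw [Dstar, Qstar, if_neg (by simp [hsupp]), hQ, ENNReal.log_ofReal_of_pos hQpos]
    rw [← EReal.coe_mul, ← EReal.coe_sub, ← EReal.coe_mul]
    congr 1
    have : α - 1 ≠ 0 := by linarith
    field_simp
  · rw [← hexp]
    exact hC N T hT
  · obtain ⟨T, hT, h0, h⟩ := (hpin N).exists_test hpq (tensorPow_mem_unitaryGroup hV N) (hx' N)
      (by rw [hsum]; exact pow_pos hQpos N)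
    refine ⟨T, hT, h0, ?_⟩
    rw [hsum, hexp, hcard, ← hs, Fintype.card_fun, Fintype.card_fin, Fintype.card_fin,
      Nat.cast_pow, Real.log_pow] at h
    exact h

end QRD

namespace QRD

open Filter

lemma IsTest.smul {m : Type*} [Fintype m] [DecidableEq m] {T : Matrix m m ℂ} (hT : IsTest T)
    {c : ℝ} (h0 : 0 ≤ c) (h1 : c ≤ 1) : IsTest ((c : ℂ) • T) := by
  refine ⟨hT.1.smul (by exact_mod_cast h0), ?_⟩
  have e : 1 - (c : ℂ) • T = ((1 - c : ℝ) : ℂ) • 1 + (c : ℂ) • (1 - T) := by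
    push_cast
    rw [smul_sub, sub_smul, one_smul]
    abel
  rw [e]
  exact (Matrix.PosSemidef.one.smul (by exact_mod_cast sub_nonneg.2 h1)).add
    (hT.2.smul (by exact_mod_cast h0))

lemma IsTest.kronecker {m m' : Type*} [Fintype m] [DecidableEq m] [Fintype m'] [DecidableEq m']
    {T : Matrix m m ℂ} {T' : Matrix m' m' ℂ} (hT : IsTest T) (hT' : IsTest T') :
    IsTest (Matrix.kronecker T T') := by
  refine ⟨hT.1.kronecker hT'.1, ?_⟩
  have e : 1 - Matrix.kronecker T T' =
      Matrix.kronecker (1 - T) 1 + Matrix.kronecker T (1 - T') := by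
    have h1 : (1 : Matrix (m × m') (m × m') ℂ) = Matrix.kronecker 1 1 :=
      Matrix.one_kronecker_one.symm
    rw [h1]
    ext i j
    simp only [Matrix.kronecker, Matrix.kroneckerMap_apply, Matrix.sub_apply, Matrix.add_apply]
    ring
  rw [e]
  exact (hT.2.kronecker Matrix.PosSemidef.one).add (hT.1.kronecker hT'.2)

lemma IsTest.submatrix {m m' : Type*} [Fintype m] [DecidableEq m] [Fintype m'] [DecidableEq m']
    {T : Matrix m m ℂ} (hT : IsTest T) (e : m' ≃ m) : IsTest (T.submatrix e e) := by
  refine ⟨hT.1.submatrix e, ?_⟩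
  have := hT.2.submatrix e
  rwa [Matrix.submatrix_sub, Pi.sub_apply, Pi.sub_apply, Matrix.submatrix_one_equiv] at this

section Region

variable {d : ℕ}

lemma tensorPow_add (A : Matrix (Fin d) (Fin d) ℂ) (m n : ℕ) :
    tensorPow A (m + n) = (Matrix.kronecker (tensorPow A m) (tensorPow A n)).submatrix
      (Fin.appendEquiv m n).symm (Fin.appendEquiv m n).symm := by
  ext x y
  simp only [tensorPow, Matrix.of_apply, Matrix.submatrix_apply, Matrix.kronecker,
    Matrix.kroneckerMap_apply, Fin.prod_univ_add]
  rfl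

lemma trace_tensorPow_add_mul (A : Matrix (Fin d) (Fin d) ℂ) {m n : ℕ}
    (T : Matrix (Fin m → Fin d) (Fin m → Fin d) ℂ)
    (T' : Matrix (Fin n → Fin d) (Fin n → Fin d) ℂ) :
    (tensorPow A (m + n) * (Matrix.kronecker T T').submatrix
      (Fin.appendEquiv m n).symm (Fin.appendEquiv m n).symm).trace =
      (tensorPow A m * T).trace * (tensorPow A n * T').trace := by
  rw [tensorPow_add, Matrix.submatrix_mul_equiv]
  have h1 : Matrix.kronecker (tensorPow A m) (tensorPow A n) * Matrix.kronecker T T' =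
      Matrix.kronecker (tensorPow A m * T) (tensorPow A n * T') :=
    (Matrix.mul_kronecker_mul _ _ _ _).symm
  have h2 : (Matrix.kronecker (tensorPow A m * T) (tensorPow A n * T')).trace =
      (tensorPow A m * T).trace * (tensorPow A n * T').trace := Matrix.trace_kronecker _ _
  rw [h1, ← h2]
  exact Equiv.sum_comp (Fin.appendEquiv m n).symm
    fun i => Matrix.kronecker (tensorPow A m * T) (tensorPow A n * T') i i

/-- There is a test of size `n` with error exponents (not normalized by `n`) `x` for `σ` and `y`
for `ρ`. -/
def Achievable (ρ σ : Matrix (Fin d) (Fin d) ℂ) (n : ℕ) (x y : ℝ) : Prop :=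
  ∃ T, IsTest T ∧ Real.exp (-y) ≤ (tensorPow ρ n * T).trace.re ∧
    (tensorPow σ n * T).trace.re ≤ Real.exp (-x)

variable {ρ σ : Matrix (Fin d) (Fin d) ℂ}

lemma Achievable.mono {n : ℕ} {x y x' y' : ℝ} (h : Achievable ρ σ n x y) (hx : x' ≤ x)
    (hy : y ≤ y') : Achievable ρ σ n x' y' := by
  obtain ⟨T, hT, h1, h2⟩ := h
  exact ⟨T, hT, (Real.exp_le_exp.2 (by linarith)).trans h1,
    h2.trans (Real.exp_le_exp.2 (by linarith))⟩

lemma trace_smul_re {n : ℕ} (A T : Matrix (Fin n → Fin d) (Fin n → Fin d) ℂ) (c : ℝ) :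
    (A * ((c : ℂ) • T)).trace.re = c * (A * T).trace.re := by
  rw [Matrix.mul_smul, Matrix.trace_smul, smul_eq_mul, Complex.re_ofReal_mul]

lemma Achievable.shift {n : ℕ} {x y c : ℝ} (h : Achievable ρ σ n x y) (hc : 0 ≤ c) :
    Achievable ρ σ n (x + c) (y + c) := by
  obtain ⟨T, hT, h1, h2⟩ := h
  have hc' := Real.exp_pos (-c)
  refine ⟨((Real.exp (-c) : ℝ) : ℂ) • T,
    hT.smul hc'.le (Real.exp_le_one_iff.2 (by linarith)), ?_, ?_⟩
  · rw [trace_smul_re, neg_add, Real.exp_add, mul_comm]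
    exact mul_le_mul_of_nonneg_left h1 hc'.le
  · rw [trace_smul_re, neg_add, Real.exp_add, mul_comm (Real.exp (-x))]
    exact mul_le_mul_of_nonneg_left h2 hc'.le

lemma achievable_zero (hρ : IsDensityMatrix ρ) (hσ : IsDensityMatrix σ) (n : ℕ) :
    Achievable ρ σ n 0 0 := by
  refine ⟨1, isTest_one, ?_, ?_⟩ <;> simp [trace_tensorPow, hρ.2, hσ.2]

lemma Achievable.add (hρ : IsDensityMatrix ρ) (hσ : IsDensityMatrix σ) {m n : ℕ}
    {x y x' y' : ℝ} (h : Achievable ρ σ m x y) (h' : Achievable ρ σ n x' y') :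
    Achievable ρ σ (m + n) (x + x') (y + y') := by
  obtain ⟨T, hT, h1, h2⟩ := h
  obtain ⟨T', hT', h1', h2'⟩ := h'
  refine ⟨_, (hT.kronecker hT').submatrix (Fin.appendEquiv m n).symm, ?_, ?_⟩
  · rw [trace_tensorPow_add_mul, Complex.mul_re, trace_mul_im (posSemidef_tensorPow hρ.1 m) hT.1,
      zero_mul, sub_zero, neg_add, Real.exp_add]
    exact mul_le_mul h1 h1' (Real.exp_pos _).le ((Real.exp_pos _).le.trans h1)
  · rw [trace_tensorPow_add_mul, Complex.mul_re, trace_mul_im (posSemidef_tensorPow hσ.1 m) hT.1,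
      zero_mul, sub_zero, neg_add, Real.exp_add]
    exact mul_le_mul h2 h2' (trace_mul_re_nonneg (posSemidef_tensorPow hσ.1 n) hT'.1)
      (Real.exp_pos _).le

lemma Achievable.mul (hρ : IsDensityMatrix ρ) (hσ : IsDensityMatrix σ) {m : ℕ}
    {x y : ℝ} (h : Achievable ρ σ m x y) (k : ℕ) : Achievable ρ σ (k * m) (k * x) (k * y) := by
  induction k with
  | zero => simpa using achievable_zero hρ hσ 0
  | succ k ih =>
    have := ih.add hρ hσ h
    rw [← Nat.succ_mul] at this
    refine this.mono (le_of_eq ?_) (le_of_eq ?_) <;> push_cast <;> ring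

/-- The asymptotically achievable pairs of exponents. -/
def region (ρ σ : Matrix (Fin d) (Fin d) ℂ) : Set (ℝ × ℝ) :=
  {p | ∀ ε > 0, ∀ᶠ n : ℕ in atTop, Achievable ρ σ n (n * (p.1 - ε)) (n * (p.2 + ε))}

lemma region_mono {p p' : ℝ × ℝ} (hp : p ∈ region ρ σ) (h1 : p'.1 ≤ p.1) (h2 : p.2 ≤ p'.2) :
    p' ∈ region ρ σ := fun ε hε => by
  filter_upwards [hp ε hε] with n hn
  exact hn.mono (by gcongr) (by gcongr)

lemma region_shift {p : ℝ × ℝ} (hp : p ∈ region ρ σ) {c : ℝ} (hc : 0 ≤ c) :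
    (p.1 + c, p.2 + c) ∈ region ρ σ := fun ε hε => by
  filter_upwards [hp ε hε] with n hn
  refine (hn.shift (c := n * c) (by positivity)).mono (le_of_eq ?_) (le_of_eq ?_) <;> ring

lemma zero_mem_region (hρ : IsDensityMatrix ρ) (hσ : IsDensityMatrix σ) :
    (0, 0) ∈ region ρ σ := fun ε hε => Eventually.of_forall fun n => by
  have : (0 : ℝ) ≤ n * ε := by positivity
  exact (achievable_zero hρ hσ n).mono (by simpa using this) (by simpa using this)

lemma isClosed_region : IsClosed (region ρ σ) := by
  refine closure_subset_iff_isClosed.1 fun p hp ε hε => ?_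
  obtain ⟨q, hq, hpq⟩ := Metric.mem_closure_iff.1 hp (ε / 2) (half_pos hε)
  rw [Prod.dist_eq, max_lt_iff, Real.dist_eq, Real.dist_eq, abs_lt, abs_lt] at hpq
  filter_upwards [hq (ε / 2) (half_pos hε)] with n hn
  exact hn.mono (mul_le_mul_of_nonneg_left (by linarith) (Nat.cast_nonneg n))
    (mul_le_mul_of_nonneg_left (by linarith) (Nat.cast_nonneg n))

lemma convex_region (hρ : IsDensityMatrix ρ) (hσ : IsDensityMatrix σ) :
    Convex ℝ (region ρ σ) := by
  rw [convex_iff_forall_pos]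
  intro p hp q hq a b ha hb hab ε hε
  have hn1 : Tendsto (fun n : ℕ => ⌊a * n⌋₊) atTop atTop :=
    tendsto_nat_floor_atTop.comp (tendsto_natCast_atTop_atTop.const_mul_atTop ha)
  have hfl : ∀ n : ℕ, (⌊a * n⌋₊ : ℝ) ≤ a * n := fun n => Nat.floor_le (by positivity)
  have hfl' : ∀ n : ℕ, a * n < (⌊a * n⌋₊ : ℝ) + 1 := fun n => Nat.lt_floor_add_one _
  have hle : ∀ n : ℕ, ⌊a * n⌋₊ ≤ n := fun n => by
    have : (⌊a * n⌋₊ : ℝ) ≤ n := (hfl n).trans (mul_le_of_le_one_left (Nat.cast_nonneg n)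
      (by linarith))
    exact_mod_cast this
  have hcast : ∀ n : ℕ, ((n - ⌊a * n⌋₊ : ℕ) : ℝ) = n - ⌊a * n⌋₊ := fun n => Nat.cast_sub (hle n)
  have hn2 : Tendsto (fun n : ℕ => n - ⌊a * n⌋₊) atTop atTop := by
    rw [← tendsto_natCast_atTop_iff (R := ℝ)]
    refine tendsto_atTop_mono (fun n => ?_)
      ((tendsto_natCast_atTop_atTop (R := ℝ)).const_mul_atTop hb)
    rw [hcast]
    have := hfl n
    have e : b = 1 - a := by linarith
    rw [e]
    linarith
  have hC : ∀ᶠ n : ℕ in atTop,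
      (|p.1| + |q.1| + |p.2| + |q.2|) / (ε / 2) ≤ n :=
    tendsto_natCast_atTop_atTop.eventually_ge_atTop _
  filter_upwards [hn1.eventually (hp (ε / 2) (half_pos hε)),
    hn2.eventually (hq (ε / 2) (half_pos hε)), hC] with n h1 h2 h3
  have h := h1.add hρ hσ h2
  rw [Nat.add_sub_cancel' (hle n)] at h
  rw [div_le_iff₀ (half_pos hε)] at h3
  have hk : ∀ u v : ℝ, |(⌊a * n⌋₊ : ℝ) * u + (n - ⌊a * n⌋₊ : ℝ) * v - n * (a * u + b * v)| ≤
      |u| + |v| := fun u v => by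
    have e : (⌊a * n⌋₊ : ℝ) * u + (n - ⌊a * n⌋₊ : ℝ) * v - n * (a * u + b * v) =
        ((⌊a * n⌋₊ : ℝ) - a * n) * (u - v) := by
      have : b = 1 - a := by linarith
      rw [this]; ring
    rw [e, abs_mul]
    have h4 : |(⌊a * n⌋₊ : ℝ) - a * n| ≤ 1 := by
      rw [abs_le]
      constructor <;> linarith [hfl n, hfl' n]
    calc _ ≤ 1 * |u - v| := mul_le_mul_of_nonneg_right h4 (abs_nonneg _)
      _ ≤ _ := by rw [one_mul]; exact abs_sub u v
  have k1 := abs_le.1 (hk p.1 q.1)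
  have k2 := abs_le.1 (hk p.2 q.2)
  have p1 := abs_nonneg p.1
  have p2 := abs_nonneg p.2
  have q1 := abs_nonneg q.1
  have q2 := abs_nonneg q.2
  refine h.mono ?_ ?_ <;> rw [hcast] <;>
    simp only [Prod.fst_add, Prod.snd_add, Prod.smul_fst, Prod.smul_snd, smul_eq_mul] <;> linarith

lemma div_mem_region (hρ : IsDensityMatrix ρ) (hσ : IsDensityMatrix σ) {m : ℕ} (hm : 0 < m)
    {x y : ℝ} (h : Achievable ρ σ m x y) : (x / m, y / m) ∈ region ρ σ := fun ε hε => by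
  have hC : ∀ᶠ n : ℕ in atTop, (|x| + |y|) / ε ≤ n :=
    tendsto_natCast_atTop_atTop.eventually_ge_atTop _
  filter_upwards [hC] with n hn
  rw [div_le_iff₀ hε] at hn
  have h1 := (h.mul hρ hσ (n / m)).add hρ hσ (achievable_zero hρ hσ (n % m))
  rw [mul_comm (n / m) m, Nat.div_add_mod] at h1
  have hm' : (0 : ℝ) < m := by exact_mod_cast hm
  have hk : ∀ u : ℝ, |n * (u / m) - (n / m : ℕ) * u| ≤ |u| := fun u => by
    have e : n * (u / m) - (n / m : ℕ) * u = ((n % m : ℕ) : ℝ) / m * u := by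
      have : (n : ℝ) = m * (n / m : ℕ) + (n % m : ℕ) := by exact_mod_cast (Nat.div_add_mod n m).symm
      conv_lhs => rw [this]
      field_simp
      ring
    rw [e, abs_mul, abs_of_nonneg (by positivity)]
    refine mul_le_of_le_one_left (abs_nonneg _) ((div_le_one hm').2 ?_)
    exact_mod_cast (Nat.mod_lt n hm).le
  have k1 := abs_le.1 (hk x)
  have k2 := abs_le.1 (hk y)
  have p1 := abs_nonneg x
  have p2 := abs_nonneg y
  refine h1.mono ?_ ?_ <;> simp only [mul_sub, mul_add, add_zero] <;> linarith

end Region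

/-- A closed convex set of pairs, stable under lowering the first coordinate, raising the second
one, and raising both by the same amount, is determined by its support function at slopes in
`(0, 1)`. -/
lemma mem_of_support_bounds {A : Set (ℝ × ℝ)} (hcl : IsClosed A) (hcv : Convex ℝ A)
    (h0 : (0, 0) ∈ A)
    (hmono : ∀ p ∈ A, ∀ p' : ℝ × ℝ, p'.1 ≤ p.1 → p.2 ≤ p'.2 → p' ∈ A)
    (hshift : ∀ p ∈ A, ∀ c : ℝ, 0 ≤ c → (p.1 + c, p.2 + c) ∈ A) {r y : ℝ}
    (h : ∀ s : ℝ, 0 < s → s < 1 → ∃ Λ : ℝ, s * r - Λ ≤ y ∧ (∀ p ∈ A, s * p.1 - Λ ≤ p.2) ∧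
      ∀ ε > 0, ∃ p ∈ A, p.2 ≤ s * p.1 + ε - Λ) : (r, y) ∈ A := by
  by_contra hmem
  obtain ⟨f, u, hf, hu⟩ := geometric_hahn_banach_closed_point hcv hcl hmem
  set c₁ := f (1, 0) with hc₁
  set c₂ := f (0, 1) with hc₂
  have hfe : ∀ p : ℝ × ℝ, f p = p.1 * c₁ + p.2 * c₂ := fun p => by
    have : p = p.1 • ((1 : ℝ), (0 : ℝ)) + p.2 • ((0 : ℝ), (1 : ℝ)) := by
      ext <;> simp
    conv_lhs => rw [this]
    rw [map_add, map_smul, map_smul, smul_eq_mul, smul_eq_mul]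
  have hu0 : 0 < u := by
    have := hf _ h0
    rw [hfe] at this
    simpa using this
  have hscale : ∀ v : ℝ, (∀ t : ℝ, 0 ≤ t → t * v < u) → v ≤ 0 := fun v hv => by
    by_contra hpos
    push Not at hpos
    have := hv (u / v) (by positivity)
    rw [div_mul_cancel₀ _ hpos.ne'] at this
    exact lt_irrefl _ this
  have hc1 : 0 ≤ c₁ := by
    refine neg_nonpos.1 (hscale _ fun t ht => ?_)
    have := hf _ (hmono _ h0 (-t, 0) (by simpa using ht) le_rfl)
    rw [hfe] at this
    simpa using this
  have hc2 : c₂ ≤ 0 := by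
    refine hscale _ fun t ht => ?_
    have := hf _ (hmono _ h0 (0, t) le_rfl (by simpa using ht))
    rw [hfe] at this
    simpa using this
  have hc12 : c₁ + c₂ ≤ 0 := by
    refine hscale _ fun t ht => ?_
    have := hf _ (hshift _ h0 t ht)
    rw [hfe] at this
    simp only [zero_add] at this
    linarith
  rw [hfe] at hu
  have hc2' : c₂ < 0 := by
    refine lt_of_le_of_ne hc2 fun h2 => ?_
    have : c₁ = 0 := by linarith
    rw [this, h2] at hu
    simp only [mul_zero, add_zero] at hu
    linarith
  obtain ⟨k, hk⟩ : ∃ k, k = -c₂ := ⟨_, rfl⟩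
  have hk0 : 0 < k := by linarith
  obtain ⟨s₀, hs₀⟩ : ∃ s, s = c₁ / k := ⟨_, rfl⟩
  have hs0 : 0 ≤ s₀ := by rw [hs₀]; positivity
  have hs1 : s₀ ≤ 1 := by rw [hs₀, div_le_one hk0]; linarith
  have hck : c₁ = s₀ * k := by rw [hs₀, div_mul_cancel₀ _ hk0.ne']
  obtain ⟨δ, hδ⟩ : ∃ δ, δ = (r * c₁ + y * c₂ - u) / k := ⟨_, rfl⟩
  have hδ0 : 0 < δ := by
    rw [hδ]
    exact div_pos (by linarith) hk0
  have hsep : ∀ p ∈ A, y - s₀ * r + δ + s₀ * p.1 ≤ p.2 := fun p hp => by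
    have h1 := hf p hp
    rw [hfe] at h1
    have h2 : δ * k = r * c₁ + y * c₂ - u := by rw [hδ, div_mul_cancel₀ _ hk0.ne']
    have hc2k : c₂ = -k := by linarith
    rw [hck, hc2k] at h1 h2
    have : (y - s₀ * r + δ + s₀ * p.1) * k ≤ p.2 * k := by nlinarith
    exact le_of_mul_le_mul_right this hk0
  obtain ⟨Λ₁, -, hΛ₁, -⟩ := h (1 / 2) (by norm_num) (by norm_num)
  obtain ⟨M, hM⟩ : ∃ M, M = |y| + |r| + |Λ₁| + δ := ⟨_, rfl⟩
  have hM0 : 0 < M := by rw [hM]; positivity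
  obtain ⟨t, ht⟩ : ∃ t, t = δ / (4 * M) := ⟨_, rfl⟩
  have ht0 : 0 < t := by rw [ht]; positivity
  have htM : t * M = δ / 4 := by rw [ht]; field_simp
  have ht1 : t < 1 := by
    rw [ht, div_lt_one (by positivity), hM]
    linarith [abs_nonneg y, abs_nonneg r, abs_nonneg Λ₁]
  obtain ⟨Λ, hΛy, -, hΛ⟩ := h ((1 - t) * s₀ + t / 2)
    (by have : 0 ≤ (1 - t) * s₀ := mul_nonneg (by linarith) hs0
        linarith)
    (by have : (1 - t) * s₀ ≤ (1 - t) * 1 := mul_le_mul_of_nonneg_left hs1 (by linarith)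
        linarith)
  obtain ⟨p, hp, hpΛ⟩ := hΛ (δ / 4) (by positivity)
  have g1 := mul_le_mul_of_nonneg_left (hsep p hp) (by linarith : 0 ≤ 1 - t)
  have g2 := mul_le_mul_of_nonneg_left (hΛ₁ p hp) ht0.le
  have b1 : t * y ≤ t * |y| := mul_le_mul_of_nonneg_left (le_abs_self y) ht0.le
  have b2 : t * (-r) ≤ t * |r| := mul_le_mul_of_nonneg_left (neg_le_abs r) ht0.le
  have b3 : t * Λ₁ ≤ t * |Λ₁| := mul_le_mul_of_nonneg_left (le_abs_self Λ₁) ht0.le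
  have b4 : 0 ≤ t * |r| := by positivity
  rw [hM] at htM
  nlinarith

end QRD

namespace QRD

open Filter

lemma eventually_poly_mul_log_le_exp (d : ℕ) {ε : ℝ} (hε : 0 < ε) :
    ∀ᶠ n : ℕ in atTop,
      ((n : ℝ) + 1) ^ (2 * d) * (1 + n * Real.log d) ≤ Real.exp (n * ε) := by
  have h := (isLittleO_pow_exp_pos_mul_atTop (2 * d + 1) hε).comp_tendsto
    (tendsto_atTop_add_const_right atTop (1 : ℝ) (tendsto_natCast_atTop_atTop (R := ℝ)))
  have hc : 0 < Real.exp (-ε) / (1 + d) := by positivity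
  filter_upwards [h.bound hc] with n hn
  simp only [Function.comp_apply, Real.norm_eq_abs, Real.abs_exp] at hn
  rw [abs_of_nonneg (by positivity)] at hn
  have hlog : Real.log d ≤ d := Real.log_le_self (Nat.cast_nonneg d)
  have h1 : 1 + n * Real.log d ≤ (n + 1) * (1 + d) := by
    have := mul_le_mul_of_nonneg_left hlog (Nat.cast_nonneg (α := ℝ) n)
    have hn0 := Nat.cast_nonneg (α := ℝ) n
    have hd0 := Nat.cast_nonneg (α := ℝ) d
    nlinarith
  calc ((n : ℝ) + 1) ^ (2 * d) * (1 + n * Real.log d)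
      ≤ ((n : ℝ) + 1) ^ (2 * d) * ((n + 1) * (1 + d)) := by gcongr
    _ = ((n : ℝ) + 1) ^ (2 * d + 1) * (1 + d) := by ring
    _ ≤ Real.exp (-ε) / (1 + d) * Real.exp (ε * (n + 1)) * (1 + d) := by gcongr
    _ = Real.exp (-ε) * Real.exp (ε * (n + 1)) := by field_simp
    _ = Real.exp (n * ε) := by rw [← Real.exp_add]; ring_nf

section Exponent

variable {d : ℕ} {ρ σ : Matrix (Fin d) (Fin d) ℂ}

lemma exists_rate_function (hρ : IsDensityMatrix ρ) (hσ : IsDensityMatrix σ)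
    (hsupp : suppLE ρ σ) {α : ℝ} (hα : 1 < α) :
    ∃ Λ : ℝ,
      (∀ r : ℝ, (((α - 1) / α : ℝ) : EReal) * ((r : EReal) - Dstar α ρ σ) =
        (((α - 1) / α * r - Λ : ℝ) : EReal)) ∧
      (∀ ε > 0, ∀ᶠ n : ℕ in atTop, ∀ T, IsTest T → ∀ x : ℝ,
        (tensorPow σ n * T).trace.re ≤ Real.exp (-(n * x)) →
        (tensorPow ρ n * T).trace.re ≤ Real.exp (-(n * ((α - 1) / α * x - Λ - ε)))) ∧
      ∀ ε > 0, ∃ p ∈ region ρ σ, p.2 ≤ (α - 1) / α * p.1 + ε - Λ := by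
  obtain ⟨Λ, h1, h2, h3⟩ := exists_rate_bounds hρ hσ hsupp hα
  have hs : 0 ≤ (α - 1) / α := div_nonneg (by linarith) (by linarith)
  refine ⟨Λ, h1, fun ε hε => ?_, fun ε hε => ?_⟩
  · filter_upwards [eventually_poly_mul_log_le_exp d hε] with n hn T hT x hx
    have hlog : 1 ≤ 1 + n * Real.log d := by
      have := Real.log_natCast_nonneg d
      have : 0 ≤ n * Real.log d := by positivity
      linarith
    have hpoly : ((n : ℝ) + 1) ^ (2 * d) ≤ Real.exp (n * ε) :=
      (le_mul_of_one_le_right (by positivity) hlog).trans hn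
    have hpow : (tensorPow σ n * T).trace.re ^ ((α - 1) / α) ≤
        Real.exp (-(n * x) * ((α - 1) / α)) := by
      rw [Real.exp_mul]
      exact Real.rpow_le_rpow (trace_mul_re_nonneg (posSemidef_tensorPow hσ.1 n) hT.1) hx hs
    calc _ ≤ _ := h2 n T hT
      _ ≤ Real.exp (n * ε) * (Real.exp (n * Λ) * Real.exp (-(n * x) * ((α - 1) / α))) :=
        mul_le_mul hpoly (mul_le_mul_of_nonneg_left hpow (Real.exp_pos _).le)
          (mul_nonneg (Real.exp_pos _).le (Real.rpow_nonneg
            (trace_mul_re_nonneg (posSemidef_tensorPow hσ.1 n) hT.1) _)) (Real.exp_pos _).le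
      _ = _ := by rw [← Real.exp_add, ← Real.exp_add]; ring_nf
  · obtain ⟨n, hn, hn0⟩ := ((eventually_poly_mul_log_le_exp d hε).and
      (eventually_gt_atTop 0)).exists
    obtain ⟨T, hT, hτ, h⟩ := h3 n
    have hn' : (0 : ℝ) < n := by exact_mod_cast hn0
    have hω : Real.exp (n * Λ) * (tensorPow σ n * T).trace.re ^ ((α - 1) / α) ≤
        Real.exp (n * ε) * (tensorPow ρ n * T).trace.re :=
      h.trans (mul_le_mul_of_nonneg_right hn
        (trace_mul_re_nonneg (posSemidef_tensorPow hρ.1 n) hT.1))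
    have hpos : 0 < (tensorPow ρ n * T).trace.re :=
      pos_of_mul_pos_right (lt_of_lt_of_le (by positivity) hω) (Real.exp_pos _).le
    refine ⟨_, div_mem_region hρ hσ hn0 (x := -Real.log (tensorPow σ n * T).trace.re)
      (y := -Real.log (tensorPow ρ n * T).trace.re) ⟨T, hT, ?_, ?_⟩, ?_⟩
    · rw [neg_neg, Real.exp_log hpos]
    · rw [neg_neg, Real.exp_log hτ]
    · have hl := Real.log_le_log (by positivity) hω
      rw [Real.log_mul (Real.exp_pos _).ne' (by positivity), Real.log_mul (Real.exp_pos _).ne'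
        hpos.ne', Real.log_exp, Real.log_exp, Real.log_rpow hτ] at hl
      refine le_of_mul_le_mul_right ?_ hn'
      simp only
      rw [div_mul_cancel₀ _ hn'.ne', sub_mul, add_mul, mul_assoc, div_mul_cancel₀ _ hn'.ne']
      linarith

lemma region_le {s Λ : ℝ} (hs1 : s ≤ 1)
    (h : ∀ ε > 0, ∀ᶠ n : ℕ in atTop, ∀ T, IsTest T → ∀ x : ℝ,
      (tensorPow σ n * T).trace.re ≤ Real.exp (-(n * x)) →
      (tensorPow ρ n * T).trace.re ≤ Real.exp (-(n * (s * x - Λ - ε))))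
    {p : ℝ × ℝ} (hp : p ∈ region ρ σ) : s * p.1 - Λ ≤ p.2 := by
  refine le_of_forall_pos_le_add fun ε hε => ?_
  have hε3 : 0 < ε / 3 := by positivity
  obtain ⟨n, ⟨h1, T, hT, hω, hτ⟩, hn0⟩ :=
    (((h _ hε3).and (hp _ hε3)).and (eventually_gt_atTop 0)).exists
  have hn' : (0 : ℝ) < n := by exact_mod_cast hn0
  have h2 := hω.trans (h1 T hT _ hτ)
  rw [Real.exp_le_exp, neg_le_neg_iff] at h2
  have h3 := le_of_mul_le_mul_left h2 hn'
  have h4 : s * (ε / 3) ≤ 1 * (ε / 3) := mul_le_mul_of_nonneg_right hs1 hε3.le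
  linarith

/-- The real points above the Hoeffding anti-divergence are achievable. -/
lemma mem_region_of_Hstar_le (hρ : IsDensityMatrix ρ) (hσ : IsDensityMatrix σ)
    (hsupp : suppLE ρ σ) {r y : ℝ} (hy : Hstar r ρ σ ≤ y) : (r, y) ∈ region ρ σ := by
  refine mem_of_support_bounds isClosed_region (convex_region hρ hσ) (zero_mem_region hρ hσ)
    (fun p hp p' => region_mono hp) (fun p hp c => region_shift hp) fun s hs0 hs1 => ?_
  have hs1' : 0 < 1 - s := by linarith
  have hα : 1 < 1 / (1 - s) := by rw [lt_div_iff₀ hs1']; linarith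
  have hs : (1 / (1 - s) - 1) / (1 / (1 - s)) = s := by field_simp; ring
  obtain ⟨Λ, h1, h2, h3⟩ := exists_rate_function hρ hσ hsupp hα
  rw [hs] at h1 h2 h3
  refine ⟨Λ, ?_, fun p hp => region_le hs1.le h2 hp, h3⟩
  have := (le_iSup₂ (f := fun (α : ℝ) (_ : α ∈ Set.Ioi (1 : ℝ)) =>
    (((α - 1) / α : ℝ) : EReal) * ((r : EReal) - Dstar α ρ σ)) _ hα).trans hy
  rw [hs, h1] at this
  exact_mod_cast this

lemma le_expRate {n : ℕ} (hn : 0 < n) {x z : ℝ} (hx : 0 ≤ x) (h : x ≤ Real.exp (-(n * z))) :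
    (z : EReal) ≤ expRate n x := by
  have hn' : (0 : ℝ) < n := by exact_mod_cast hn
  rw [expRate]
  split_ifs with h0
  · exact le_top
  · have := Real.log_le_log (lt_of_le_of_ne hx (Ne.symm h0)) h
    rw [Real.log_exp] at this
    rw [EReal.coe_le_coe_iff, neg_mul, inv_mul_eq_div, le_neg, div_le_iff₀ hn']
    linarith

lemma le_exp_of_le_expRate {n : ℕ} (hn : 0 < n) {x z : ℝ} (hx : 0 ≤ x)
    (h : (z : EReal) ≤ expRate n x) : x ≤ Real.exp (-(n * z)) := by
  have hn' : (0 : ℝ) < n := by exact_mod_cast hn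
  rw [expRate] at h
  split_ifs at h with h0
  · rw [h0]; positivity
  · rw [EReal.coe_le_coe_iff, neg_mul, inv_mul_eq_div, le_neg, div_le_iff₀ hn'] at h
    rw [← Real.log_le_iff_le_exp (lt_of_le_of_ne hx (Ne.symm h0))]
    linarith

lemma expRate_exp {n : ℕ} (hn : 0 < n) (y : ℝ) :
    expRate n (Real.exp (-(n * y))) = (y : EReal) := by
  have hn' : (n : ℝ) ≠ 0 := by exact_mod_cast hn.ne'
  rw [expRate, if_neg (Real.exp_pos _).ne', Real.log_exp]
  congr 1
  field_simp

lemma Hstar_le_scZero (hρ : IsDensityMatrix ρ) (hσ : IsDensityMatrix σ)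
    (hsupp : suppLE ρ σ) (r : ℝ) : Hstar r ρ σ ≤ scZero r ρ σ := by
  refine iSup₂_le fun α hα => le_sInf ?_
  rintro x ⟨T, hT, hσT, hρT⟩
  obtain ⟨Λ, h1, h2, -⟩ := exists_rate_function hρ hσ hsupp hα
  rw [h1]
  refine EReal.ge_of_forall_gt_iff_ge.1 fun z hz => ?_
  rw [EReal.coe_lt_coe_iff] at hz
  refine ge_of_tendsto hρT ?_
  filter_upwards [h2 _ (sub_pos.2 hz), eventually_lt_of_lt_liminf hσT,
    eventually_gt_atTop 0] with n hn hr hn0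
  refine le_expRate hn0 (trace_mul_re_nonneg (posSemidef_tensorPow hρ.1 n) (hT n).1) ?_
  have := hn (T n) (hT n) r (le_exp_of_le_expRate hn0
    (trace_mul_re_nonneg (posSemidef_tensorPow hσ.1 n) (hT n).1) hr.le)
  rwa [sub_sub_cancel] at this

lemma scZero_le_Hstar (hρ : IsDensityMatrix ρ) (hσ : IsDensityMatrix σ)
    (hsupp : suppLE ρ σ) (r : ℝ) : scZero r ρ σ ≤ Hstar r ρ σ := by
  refine EReal.le_of_forall_lt_iff_le.1 fun y hy => ?_
  obtain ⟨y₁, hy₁, hy₁y⟩ := EReal.lt_iff_exists_real_btwn.1 hy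
  rw [EReal.coe_lt_coe_iff] at hy₁y
  have hmem := mem_region_of_Hstar_le hρ hσ hsupp hy₁.le
  obtain ⟨ε, hε⟩ : ∃ ε, ε = (y - y₁) / 3 := ⟨_, rfl⟩
  have hε0 : 0 < ε := by rw [hε]; linarith
  have hach : ∀ᶠ n : ℕ in atTop, ∃ T, IsTest T ∧
      (tensorPow ρ n * T).trace.re = Real.exp (-(n * y)) ∧
      (tensorPow σ n * T).trace.re ≤ Real.exp (-(n * (r + ε))) := by
    filter_upwards [hmem ε hε0] with n hn
    have hnn := Nat.cast_nonneg (α := ℝ) n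
    obtain ⟨T, hT, hω, hτ⟩ := hn.shift (c := 2 * n * ε) (by positivity)
    have hω0 := (Real.exp_pos _).trans_le hω
    have hle : Real.exp (-(n * y)) ≤ (tensorPow ρ n * T).trace.re :=
      (Real.exp_le_exp.2 (le_of_eq (by simp only [hε]; ring))).trans hω
    have hc : Real.exp (-(n * y)) / (tensorPow ρ n * T).trace.re ≤ 1 := (div_le_one hω0).2 hle
    refine ⟨_, hT.smul (c := Real.exp (-(n * y)) / (tensorPow ρ n * T).trace.re)
      (by positivity) hc, ?_, ?_⟩
    · rw [trace_smul_re, div_mul_cancel₀ _ hω0.ne']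
    · rw [trace_smul_re]
      refine (mul_le_of_le_one_left
        (trace_mul_re_nonneg (posSemidef_tensorPow hσ.1 n) hT.1) hc).trans (hτ.trans ?_)
      exact Real.exp_le_exp.2 (le_of_eq (by ring))
  have hex : ∀ n : ℕ, ∃ T : Matrix (Fin n → Fin d) (Fin n → Fin d) ℂ, IsTest T ∧
      ((∃ T, IsTest T ∧ (tensorPow ρ n * T).trace.re = Real.exp (-(n * y)) ∧
        (tensorPow σ n * T).trace.re ≤ Real.exp (-(n * (r + ε)))) →
      (tensorPow ρ n * T).trace.re = Real.exp (-(n * y)) ∧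
        (tensorPow σ n * T).trace.re ≤ Real.exp (-(n * (r + ε)))) := fun n => by
    by_cases h : ∃ T, IsTest T ∧ (tensorPow ρ n * T).trace.re = Real.exp (-(n * y)) ∧
        (tensorPow σ n * T).trace.re ≤ Real.exp (-(n * (r + ε)))
    · obtain ⟨T, hT, h'⟩ := h
      exact ⟨T, hT, fun _ => h'⟩
    · exact ⟨1, isTest_one, fun h' => absurd h' h⟩
  choose T hT hTe using hex
  refine sInf_le ⟨T, hT, ?_, ?_⟩
  · refine lt_of_lt_of_le (EReal.coe_lt_coe_iff.2 (lt_add_of_pos_right r hε0))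
      (le_liminf_of_le (by isBoundedDefault) ?_)
    filter_upwards [hach, eventually_gt_atTop 0] with n hn hn0
    exact le_expRate hn0 (trace_mul_re_nonneg (posSemidef_tensorPow hσ.1 n) (hT n).1)
      (hTe n hn).2
  · refine tendsto_const_nhds.congr' ?_
    filter_upwards [hach, eventually_gt_atTop 0] with n hn hn0
    rw [(hTe n hn).1, expRate_exp hn0]

end Exponent

end QRD

open QRD in
/-- For density matrices `ρ`, `σ` on `ℂ^d` with `s(ρ) ≤ s(σ)` and every `r ≥ 0`,
the strong converse exponent `sc⁰_r(ρ‖σ)` equals the Hoeffding anti-divergence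
`H*_r(ρ‖σ)`. -/
theorem scZero_eq_hoeffdingAntiDivergence
    {d : ℕ} (ρ σ : Matrix (Fin d) (Fin d) ℂ)
    (hρ : IsDensityMatrix ρ) (hσ : IsDensityMatrix σ)
    (hsupp : suppLE ρ σ) (r : ℝ) (hr : 0 ≤ r) :
    scZero r ρ σ = Hstar r ρ σ := by
  exact (scZero_le_Hstar hρ hσ hsupp r).antisymm (Hstar_le_scZero hρ hσ hsupp r)
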